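/- Let k ≥ 1 and n be natural numbers, and let N_k be the nonorientable genus-k surface group. For any two surjective group homomorphisms φ, ψ : F_n →* N_k there exists an automorphism α of F_n with ψ ∘ α = φ. In other words, Aut(F_n) acts transitively on the set of epimorphisms from F_n onto N_k. -/

import Mathlib

/-- The single relator `x_0² x_1² ⋯ x_{k-1}²` of the nonorientable genus-`k`
surface group, as an element of the free group on `Fin k`. -/
def nonorientableRelator (k : ℕ) : FreeGroup (Fin k) :=
  ((List.finRange k).map (fun i => (FreeGroup.of i) ^ 2)).prod

/-- The nonorientable genus-`k` surface group. -/
def NonorientableSurfaceGroup (k : ℕ) : Type :=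
  PresentedGroup ({nonorientableRelator k} : Set (FreeGroup (Fin k)))

instance (k : ℕ) : Group (NonorientableSurfaceGroup k) :=
  inferInstanceAs (Group (PresentedGroup _))

/-- The standard epimorphism `ρ_k : F_k →* N_k`, the quotient map of the presentation. -/
def standardRho (k : ℕ) : FreeGroup (Fin k) →* NonorientableSurfaceGroup k :=
  PresentedGroup.mk _

namespace NSG

/-- `Conn src tgt a u v h`: there is an edge path from `u` to `v` with product of values `h`. -/
inductive Conn {V E H : Type} [Group H] (src tgt : E → V) (a : E → H) : V → V → H → Prop
  | refl (v : V) : Conn src tgt a v v 1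
  | fwd {u : V} {h : H} (e : E) : Conn src tgt a u (src e) h → Conn src tgt a u (tgt e) (h * a e)
  | bwd {u : V} {h : H} (e : E) :
      Conn src tgt a u (tgt e) h → Conn src tgt a u (src e) (h * (a e)⁻¹)

namespace Conn

variable {V E H V' E' H' : Type} [Group H] [Group H'] {src tgt : E → V} {a : E → H}
  {src' tgt' : E' → V'} {a' : E' → H'}

theorem trans {u v w : V} {h h' : H} (p : Conn src tgt a u v h) (q : Conn src tgt a v w h') :
    Conn src tgt a u w (h * h') := by
  induction q with
  | refl => simpa using p
  | fwd e _ ih => rw [← mul_assoc]; exact fwd e ih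
  | bwd e _ ih => rw [← mul_assoc]; exact bwd e ih

theorem edge (e : E) : Conn src tgt a (src e) (tgt e) (a e) := by
  simpa using fwd (a := a) e (refl (src e))

theorem edge' (e : E) : Conn src tgt a (tgt e) (src e) (a e)⁻¹ := by
  simpa using bwd (a := a) e (refl (tgt e))

theorem symm {u v : V} {h : H} (p : Conn src tgt a u v h) : Conn src tgt a v u h⁻¹ := by
  induction p with
  | refl => simpa using refl (a := a) _
  | fwd e _ ih => rw [mul_inv_rev]; exact (edge' e).trans ih
  | bwd e _ ih => rw [mul_inv_rev, inv_inv]; exact (edge e).trans ih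

theorem cast {u v u' v' : V} {h h' : H} (p : Conn src tgt a u v h) (hu : u = u') (hv : v = v')
    (hh : h = h') : Conn src tgt a u' v' h' := by
  subst hu hv hh; exact p

/-- Transport of paths under a vertex map, a homomorphism and a gauge. -/
theorem map (f : V → V') (b : V → H') (ψ : H →* H')
    (hE : ∀ e, Conn src' tgt' a' (f (src e)) (f (tgt e)) (b (src e) * ψ (a e) * (b (tgt e))⁻¹))
    {u v : V} {h : H} (p : Conn src tgt a u v h) :
    Conn src' tgt' a' (f u) (f v) (b u * ψ h * (b v)⁻¹) := by
  induction p with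
  | refl => exact (refl _).cast rfl rfl (by simp)
  | fwd e _ ih => exact (ih.trans (hE e)).cast rfl rfl (by simp [mul_assoc])
  | bwd e _ ih => exact (ih.trans (hE e).symm).cast rfl rfl (by simp [mul_assoc])

theorem map' (f : V → V')
    (ψ : H →* H') (hE : ∀ e, Conn src' tgt' a' (f (src e)) (f (tgt e)) (ψ (a e)))
    {u v : V} {h : H} (p : Conn src tgt a u v h) :
    Conn src' tgt' a' (f u) (f v) (ψ h) := by
  have := p.map f (fun _ => 1) ψ (a' := a') (src' := src') (tgt' := tgt') (by simpa using hE)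
  simpa using this

theorem hom_eq (f₁ f₂ : H →* H') (c : V → H')
    (hE : ∀ e, f₁ (a e) = c (src e) * f₂ (a e) * (c (tgt e))⁻¹)
    {u v : V} {h : H} (p : Conn src tgt a u v h) : f₁ h = c u * f₂ h * (c v)⁻¹ := by
  induction p with
  | refl => simp
  | fwd e _ ih => rw [map_mul, map_mul, ih, hE]; group
  | bwd e _ ih => rw [map_mul, map_mul, map_inv, map_inv, ih, hE]; group

theorem lift (b : E → H') {u v : V} {h : H} (p : Conn src tgt a u v h) :
    ∃ w, Conn src tgt (fun e => (b e, a e)) u v (w, h) := by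
  induction p with
  | refl => exact ⟨1, refl _⟩
  | fwd e _ ih => obtain ⟨w, hw⟩ := ih; exact ⟨_, fwd e hw⟩
  | bwd e _ ih => obtain ⟨w, hw⟩ := ih; exact ⟨_, bwd e hw⟩

theorem mem_closure {u v : V} {h : H} (p : Conn src tgt a u v h) :
    h ∈ Subgroup.closure (Set.range a) := by
  induction p with
  | refl => exact one_mem _
  | fwd e _ ih => exact mul_mem ih (Subgroup.subset_closure ⟨e, rfl⟩)
  | bwd e _ ih => exact mul_mem ih (inv_mem (Subgroup.subset_closure ⟨e, rfl⟩))

theorem eq_of_loops (hl : ∀ e, src e = tgt e) {u v : V} {h : H} (p : Conn src tgt a u v h) :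
    u = v := by
  induction p with
  | refl => rfl
  | fwd e _ ih => rw [ih, hl]
  | bwd e _ ih => rw [ih, hl]

/-- A property of vertices closed under edges propagates. -/
theorem closed (P : V → Prop) (h1 : ∀ e, P (src e) → P (tgt e)) (h2 : ∀ e, P (tgt e) → P (src e))
    {u v : V} {h : H} (p : Conn src tgt a u v h) (hu : P u) : P v := by
  induction p with
  | refl => exact hu
  | fwd e _ ih => exact h1 e ih
  | bwd e _ ih => exact h2 e ih

end Conn

/-- `φ` kills a member of some `n`-element generating tuple of `F_n`. -/
def Red {n : ℕ} {G : Type} [Group G] (φ : FreeGroup (Fin n) →* G) : Prop :=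
  ∃ y : Fin n → FreeGroup (Fin n), Subgroup.closure (Set.range y) = ⊤ ∧ ∃ j, φ (y j) = 1

/-- the vertex map identifying `w'` with `w` -/
noncomputable def idf {V : Type} (w w' : V) (h : w ≠ w') (v : V) : {v : V // v ≠ w'} :=
  open Classical in if hv : v = w' then ⟨w, h⟩ else ⟨v, hv⟩

theorem idf_surj {V : Type} (w w' : V) (h : w ≠ w') : Function.Surjective (idf w w' h) := by
  rintro ⟨v, hv⟩
  exact ⟨v, by simp [idf, hv]⟩

theorem idf_self {V : Type} (w w' : V) (h : w ≠ w') (v : {v : V // v ≠ w'}) :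
    idf w w' h v = v := by
  simp [idf, v.2]

theorem idf_w {V : Type} (w w' : V) (h : w ≠ w') : idf w w' h w = idf w w' h w' := by
  simp [idf]

theorem idf_apply {V Q : Type} (w w' : V) (h : w ≠ w') (b : V → Q) (hb : b w = b w') (v : V) :
    b (idf w w' h v) = b v := by
  unfold idf
  split_ifs with hv
  · subst hv; exact hb
  · rfl

theorem card_ne {V : Type} [Finite V] (w : V) : Nat.card {v : V // v ≠ w} + 1 = Nat.card V := by
  classical
  have := Fintype.ofFinite V
  rw [Nat.card_eq_fintype_card, Nat.card_eq_fintype_card, Fintype.card_subtype_compl,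
    Fintype.card_subtype_eq]
  have : 0 < Fintype.card V := Fintype.card_pos_iff.2 ⟨w⟩
  omega

theorem lemmaS {n : ℕ} {G : Type} [Group G] (φ : FreeGroup (Fin n) →* G) (m : ℕ) :
    ∀ (V E : Type) [Finite V] [Finite E] (src tgt : E → V) (a : E → FreeGroup (Fin n)),
      Nat.card V = m → (∀ u v q, Conn src tgt a u v q) → Nat.card E + 1 = Nat.card V + n →
      (∃ e, src e = tgt e ∧ φ (a e) = 1) → Red φ := by
  induction m with
  | zero =>
    intro V E _ _ src tgt a hV _ _ ⟨e, _⟩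
    have : Nonempty V := ⟨src e⟩
    exact absurd hV Nat.card_pos.ne'
  | succ m ih =>
    intro V E _ _ src tgt a hV hG hc ⟨e, he, hφ⟩
    classical
    by_cases hl : ∀ e, src e = tgt e
    · have hs : Subsingleton V := ⟨fun u v => (hG u v 1).eq_of_loops hl⟩
      have : Nonempty V := ⟨src e⟩
      have h1 : Nat.card V = 1 := Nat.card_of_subsingleton (src e)
      have hE : Nat.card E = n := by omega
      let eq : E ≃ Fin n := Finite.equivFinOfCardEq hE
      refine ⟨a ∘ eq.symm, ?_, eq e, by simpa using hφ⟩
      rw [eq_top_iff]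
      intro q _
      rw [eq.symm.surjective.range_comp]
      exact (hG (src e) (src e) q).mem_closure
    · push Not at hl
      obtain ⟨d, hd⟩ := hl
      have hde : e ≠ d := by rintro rfl; exact hd he
      let h : V → FreeGroup (Fin n) := fun v => if v = tgt d then a d else 1
      let f := idf (src d) (tgt d) hd
      let a' : E → FreeGroup (Fin n) := fun e => h (src e) * a e * (h (tgt e))⁻¹
      have had : a' d = 1 := by simp [a', h, hd]
      refine ih {v // v ≠ tgt d} {e // e ≠ d} (fun e => f (src e)) (fun e => f (tgt e))
        (fun e => a' e) ?_ ?_ ?_ ⟨⟨e, hde⟩, ?_, ?_⟩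
      · have := card_ne (tgt d); omega
      · intro u v q
        have key := (hG u v ((h u)⁻¹ * q * h v)).map f h (MonoidHom.id _)
          (src' := fun e : {e // e ≠ d} => f (src e)) (tgt' := fun e : {e // e ≠ d} => f (tgt e))
          (a' := fun e : {e // e ≠ d} => a' e) ?_
        · exact key.cast (idf_self ..) (idf_self ..) (by simp [mul_assoc])
        · intro c
          by_cases hcd : c = d
          · subst hcd
            have : f (src c) = f (tgt c) := idf_w ..
            rw [this]
            exact (Conn.refl _).cast rfl rfl had.symm
          · exact Conn.edge (src := fun e : {e // e ≠ d} => f (src e))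
              (tgt := fun e : {e // e ≠ d} => f (tgt e)) 
              (a := fun e : {e // e ≠ d} => a' e) ⟨c, hcd⟩
      · have := card_ne (tgt d); have := card_ne d; omega
      · simp [he]
      · simp [a', he, hφ]

/-- Parallel edges with equal image. -/
theorem red_of_parallel {n : ℕ} {G : Type} [Group G] (φ : FreeGroup (Fin n) →* G)
    (V E : Type) [Finite V] [Finite E] (src tgt : E → V) (a : E → FreeGroup (Fin n))
    (hG : ∀ u v q, Conn src tgt a u v q) (hc : Nat.card E + 1 = Nat.card V + n)
    (e e' : E) (hne : e ≠ e') (hs : src e = src e') (ht : tgt e = tgt e')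
    (hφ : φ (a e) = φ (a e')) : Red φ := by
  classical
  refine lemmaS φ _ V E src (Function.update tgt e (src e))
    (Function.update a e (a e * (a e')⁻¹)) rfl ?_ hc ⟨e, by simp, by simp [hφ]⟩
  intro u v q
  refine (hG u v q).map' id (MonoidHom.id _) ?_
  have old : ∀ c, c ≠ e → Conn src (Function.update tgt e (src e))
    (Function.update a e (a e * (a e')⁻¹)) (src c) (tgt c) (a c) := by
    intro c hc
    exact (Conn.edge c).cast rfl (by simp [hc]) (by simp [hc])
  intro c
  by_cases hc : c = e
  · subst hc
    have h1 := Conn.edge (src := src) (tgt := Function.update tgt c (src c))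
      (a := Function.update a c (a c * (a e')⁻¹)) c
    have h2 := old e' (Ne.symm hne)
    rw [Function.update_self, Function.update_self] at h1
    rw [← hs, ← ht] at h2
    exact (h1.trans h2).cast rfl rfl (by simp)
  · exact old c hc

end NSG

namespace NSG

/-- Marked graphs. -/
structure MG {n : ℕ} {L G : Type} [Group G] (x : L → G) (φ : FreeGroup (Fin n) →* G) where
  V : Type
  E : Type
  finV : Finite V
  finE : Finite E
  src : E → V
  tgt : E → V
  lab : E → L
  val : E → FreeGroup (Fin n)
  pot : V → G
  compat : ∀ e, φ (val e) = pot (src e) * x (lab e) * (pot (tgt e))⁻¹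

namespace MG

variable {n : ℕ} {L G : Type} [Group G] {x : L → G} {φ : FreeGroup (Fin n) →* G}

instance (X : MG x φ) : Finite X.V := X.finV
instance (X : MG x φ) : Finite X.E := X.finE

/-- generation relative to a subgroup -/
def GenS (X : MG x φ) (S : Subgroup (FreeGroup (Fin n))) : Prop :=
  Nonempty X.V ∧ ∀ q ∈ S, ∀ u v, Conn X.src X.tgt X.val u v q

/-- generation -/
def Gen (X : MG x φ) : Prop :=
  Nonempty X.V ∧ ∀ u v q, Conn X.src X.tgt X.val u v q

/-- the conclusion of the universal property for a given `α` -/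
def Sol (X : MG x φ) {Q : Type} [Group Q] (α : X.E → Q) : Prop :=
  ∃ (χ : FreeGroup (Fin n) →* Q) (β : X.V → Q),
    ∀ e, α e = β (X.src e) * χ (X.val e) * (β (X.tgt e))⁻¹

/-- universality -/
def U0 (X : MG x φ) : Prop :=
  ∀ (Q : Type) [Group Q] (α : X.E → Q), X.Sol α

/-- folded graphs -/
def Folded (X : MG x φ) : Prop :=
  ∀ e e', X.lab e = X.lab e' → (X.src e = X.src e' ∨ X.tgt e = X.tgt e') → e = e'

def Hom (X Y : MG x φ) (f : X.V → Y.V) : Prop :=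
  ∀ e, ∃ e', Y.src e' = f (X.src e) ∧ Y.tgt e' = f (X.tgt e) ∧ Y.lab e' = X.lab e

theorem Hom.id (X : MG x φ) : Hom X X _root_.id := fun e => ⟨e, rfl, rfl, rfl⟩

theorem Hom.comp {X Y Z : MG x φ} {f : X.V → Y.V} {g : Y.V → Z.V} (hg : Hom Y Z g)
    (hf : Hom X Y f) : Hom X Z (g ∘ f) := by
  intro e
  obtain ⟨e', h1, h2, h3⟩ := hf e
  obtain ⟨e'', h1', h2', h3'⟩ := hg e'
  exact ⟨e'', by simp [h1', h1], by simp [h2', h2], h3'.trans h3⟩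

/-- change of gauge -/
def gauge (X : MG x φ) (h : X.V → FreeGroup (Fin n)) : MG x φ where
  V := X.V
  E := X.E
  finV := X.finV
  finE := X.finE
  src := X.src
  tgt := X.tgt
  lab := X.lab
  val e := h (X.src e) * X.val e * (h (X.tgt e))⁻¹
  pot v := φ (h v) * X.pot v
  compat e := by simp [X.compat, mul_assoc]

theorem gauge_gen {X : MG x φ} (h : X.V → FreeGroup (Fin n)) (hX : X.Gen) : (X.gauge h).Gen := by
  refine ⟨hX.1, fun u v q => ?_⟩
  have := (hX.2 u v ((h u)⁻¹ * q * h v)).map (V' := X.V) id h (MonoidHom.id _) (a' := (X.gauge h).val)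
    (src' := X.src) (tgt' := X.tgt)
    (fun e => Conn.edge (src := X.src) (tgt := X.tgt) (a := (X.gauge h).val) e)
  exact this.cast rfl rfl (by simp [mul_assoc])

theorem gauge_sol {X : MG x φ} (h : X.V → FreeGroup (Fin n)) {Q : Type} [Group Q] {α : X.E → Q}
    (hX : X.Sol α) : (X.gauge h).Sol (α : X.E → Q) := by
  obtain ⟨χ, β, hα⟩ := hX
  refine ⟨χ, fun v : X.V => β v * (χ (h v))⁻¹, fun e => ?_⟩
  refine (hα e).trans ?_
  simp [gauge, mul_assoc]

/-- general quotient / restriction -/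
def push (X : MG x φ) (V' E' : Type) [Finite V'] [Finite E'] (f : X.V → V') (i : E' → X.E)
    (pot' : V' → G) (hp : ∀ v, pot' (f v) = X.pot v) : MG x φ where
  V := V'
  E := E'
  finV := inferInstance
  finE := inferInstance
  src e := f (X.src (i e))
  tgt e := f (X.tgt (i e))
  lab e := X.lab (i e)
  val e := X.val (i e)
  pot := pot'
  compat e := by simp [hp, X.compat]

theorem push_gen {X : MG x φ} (V' E' : Type) [Finite V'] [Finite E'] (f : X.V → V') (i : E' → X.E)
    (pot' : V' → G) (hp : ∀ v, pot' (f v) = X.pot v) (hX : X.Gen) (hf : Function.Surjective f)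
    (hc : ∀ e, Conn (fun e => f (X.src (i e))) (fun e => f (X.tgt (i e))) (fun e => X.val (i e))
      (f (X.src e)) (f (X.tgt e)) (X.val e)) : (X.push V' E' f i pot' hp).Gen := by
  refine ⟨hX.1.map f, fun u v q => ?_⟩
  obtain ⟨u, rfl⟩ := hf u
  obtain ⟨v, rfl⟩ := hf v
  exact (hX.2 u v q).map' f (MonoidHom.id _) hc

/-- the basic fold, after gauging -/
theorem fold0 (X : MG x φ) (e e' : X.E) (w w' : X.V) (hw : w ≠ w') (hee : e ≠ e')
    (hl : X.lab e = X.lab e') (hv : X.val e = X.val e')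
    (hst : (X.src e = X.src e' ∧ X.tgt e = w ∧ X.tgt e' = w') ∨
      (X.tgt e = X.tgt e' ∧ X.src e = w ∧ X.src e' = w')) :
    ∃ (Y : MG x φ) (f : X.V → Y.V), Hom X Y f ∧ (X.Gen → Y.Gen) ∧ (X.U0 → Y.U0) ∧
      Nat.card Y.V + 1 = Nat.card X.V ∧ Nat.card Y.E + 1 = Nat.card X.E := by
  classical
  have hpot : X.pot w = X.pot w' := by
    have h1 := X.compat e
    have h2 := X.compat e'
    rw [hv, h2] at h1
    rcases hst with ⟨a, rfl, rfl⟩ | ⟨a, rfl, rfl⟩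
    · rw [a, hl] at h1; exact (inv_injective (mul_left_cancel h1)).symm
    · rw [a, hl] at h1; exact (mul_right_cancel (mul_right_cancel h1)).symm
  let f := idf w w' hw
  have fs : f (X.src e) = f (X.src e') := by
    rcases hst with ⟨a, rfl, rfl⟩ | ⟨a, rfl, rfl⟩
    · rw [a]
    · exact idf_w _ _ hw
  have ft : f (X.tgt e) = f (X.tgt e') := by
    rcases hst with ⟨a, rfl, rfl⟩ | ⟨a, rfl, rfl⟩
    · exact idf_w _ _ hw
    · rw [a]
  let Y := X.push {v // v ≠ w'} {c // c ≠ e'} f (fun c => c) (fun v => X.pot v)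
    (idf_apply w w' hw X.pot hpot)
  refine ⟨Y, f, ?_, ?_, ?_, card_ne _, card_ne _⟩
  · intro c
    by_cases hc : c = e'
    · subst hc
      exact ⟨⟨e, hee⟩, fs, ft, hl⟩
    · exact ⟨⟨c, hc⟩, rfl, rfl, rfl⟩
  · intro hX
    refine push_gen _ _ _ _ _ _ hX (idf_surj _ _ _) ?_
    have old : ∀ c, c ≠ e' → Conn (fun e : {c // c ≠ e'} => f (X.src e)) (fun e => f (X.tgt e))
        (fun e => X.val e) (f (X.src c)) (f (X.tgt c)) (X.val c) := fun c hc =>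
      Conn.edge (src := fun e : {c // c ≠ e'} => f (X.src e)) (tgt := fun e => f (X.tgt e))
        (a := fun e => X.val e) ⟨c, hc⟩
    intro c
    by_cases hc : c = e'
    · subst hc
      exact (old e hee).cast fs ft hv
    · exact old c hc
  · intro hX Q _ α
    obtain ⟨χ, β, hα⟩ := hX Q (fun c => if hc : c = e' then α ⟨e, hee⟩ else α ⟨c, hc⟩)
    have hβ : β w = β w' := by
      have h1 := hα e
      have h2 := hα e'
      simp only [hee, dite_true, dite_false] at h1 h2
      rw [h1, hv] at h2
      rcases hst with ⟨a, rfl, rfl⟩ | ⟨a, rfl, rfl⟩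
      · rw [a] at h2; exact (inv_injective (mul_left_cancel h2))
      · rw [a] at h2; exact (mul_right_cancel (mul_right_cancel h2))
    refine ⟨χ, fun v : {v // v ≠ w'} => β v, fun (c : {c // c ≠ e'}) => ?_⟩
    have := hα c
    simp only [c.2, dite_false] at this
    refine this.trans ?_
    change _ = β (f (X.src c)) * χ (X.val c) * (β (f (X.tgt c)))⁻¹
    rw [idf_apply w w' hw β hβ, idf_apply w w' hw β hβ]

/-- one fold -/
theorem fold1 (X : MG x φ) (e e' : X.E) (hl : X.lab e = X.lab e')
    (hst : (X.src e = X.src e' ∧ X.tgt e ≠ X.tgt e') ∨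
      (X.tgt e = X.tgt e' ∧ X.src e ≠ X.src e')) :
    ∃ (Y : MG x φ) (f : X.V → Y.V), Hom X Y f ∧ (X.Gen → Y.Gen) ∧ (X.U0 → Y.U0) ∧
      Nat.card Y.V + 1 = Nat.card X.V ∧ Nat.card Y.E + 1 = Nat.card X.E := by
  classical
  have hee : e ≠ e' := by rintro rfl; simp at hst
  have main : ∀ (h : X.V → FreeGroup (Fin n)) (e e' : X.E), X.lab e = X.lab e' → e ≠ e' →
      ((X.src e = X.src e' ∧ X.tgt e ≠ X.tgt e') ∨ (X.tgt e = X.tgt e' ∧ X.src e ≠ X.src e')) →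
      (X.gauge h).val e = (X.gauge h).val e' →
      ∃ (Y : MG x φ) (f : X.V → Y.V), Hom X Y f ∧ (X.Gen → Y.Gen) ∧ (X.U0 → Y.U0) ∧
      Nat.card Y.V + 1 = Nat.card X.V ∧ Nat.card Y.E + 1 = Nat.card X.E := by
    intro h e e' hl hee hst hv
    have : ∃ w w', w ≠ w' ∧ ((X.src e = X.src e' ∧ X.tgt e = w ∧ X.tgt e' = w') ∨
      (X.tgt e = X.tgt e' ∧ X.src e = w ∧ X.src e' = w')) := by
      rcases hst with ⟨a, b⟩ | ⟨a, b⟩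
      · exact ⟨_, _, b, Or.inl ⟨a, rfl, rfl⟩⟩
      · exact ⟨_, _, b, Or.inr ⟨a, rfl, rfl⟩⟩
    obtain ⟨w, w', hw, H⟩ := this
    obtain ⟨Y, f, h1, h2, h3, h4, h5⟩ := fold0 (X.gauge h) e e' w w' hw hee hl hv H
    exact ⟨Y, f, h1, fun hX => h2 (gauge_gen h hX), fun hX => h3 fun Q _ α => gauge_sol h (hX Q α),
      h4, h5⟩
  rcases hst with ⟨a, b⟩ | ⟨a, b⟩
  · by_cases hs : X.tgt e' = X.src e
    · have hs' : X.tgt e ≠ X.src e' := by rw [← a, ← hs]; exact b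
      refine main (fun v => if v = X.tgt e then (X.val e')⁻¹ * X.val e else 1) e' e hl.symm hee.symm
        (Or.inl ⟨a.symm, b.symm⟩) ?_
      simp [gauge, hs'.symm, b.symm, a]
    · refine main (fun v => if v = X.tgt e' then (X.val e)⁻¹ * X.val e' else 1) e e' hl hee
        (Or.inl ⟨a, b⟩) ?_
      have : X.src e' ≠ X.tgt e' := by rw [← a]; exact fun h => hs h.symm
      simp [gauge, b, a, this]
  · by_cases hs : X.src e' = X.tgt e
    · have hs' : X.src e ≠ X.tgt e' := by rw [← a, ← hs]; exact b
      refine main (fun v => if v = X.src e then X.val e' * (X.val e)⁻¹ else 1) e' e hl.symm hee.symm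
        (Or.inr ⟨a.symm, b.symm⟩) ?_
      simp [gauge, hs'.symm, b.symm, a]
    · refine main (fun v => if v = X.src e' then X.val e * (X.val e')⁻¹ else 1) e e' hl hee
        (Or.inr ⟨a, b⟩) ?_
      have : X.tgt e' ≠ X.src e' := by rw [← a]; exact fun h => hs h.symm
      simp [gauge, b, a, this]

/-- the graph has a pair of parallel edges with the same label -/
def Par (X : MG x φ) : Prop :=
  ∃ e e', e ≠ e' ∧ X.lab e = X.lab e' ∧ X.src e = X.src e' ∧ X.tgt e = X.tgt e'

theorem fold (m : ℕ) : ∀ X : MG x φ, Nat.card X.V = m →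
    ∃ (Y : MG x φ) (f : X.V → Y.V), Hom X Y f ∧ (X.Gen → Y.Gen) ∧ (X.U0 → Y.U0) ∧
      Nat.card Y.V ≤ Nat.card X.V ∧ Nat.card Y.E + Nat.card X.V = Nat.card X.E + Nat.card Y.V ∧
      (Y.Folded ∨ Y.Par) := by
  induction m using Nat.strong_induction_on with
  | _ m ih =>
  intro X hm
  by_cases hF : X.Folded ∨ X.Par
  · exact ⟨X, id, Hom.id X, id, id, le_rfl, rfl, hF⟩
  · push Not at hF
    obtain ⟨h1, h2⟩ := hF
    unfold Folded at h1
    push Not at h1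
    obtain ⟨e, e', hl, hst, hee⟩ := h1
    have : (X.src e = X.src e' ∧ X.tgt e ≠ X.tgt e') ∨
      (X.tgt e = X.tgt e' ∧ X.src e ≠ X.src e') := by
      by_cases a : X.src e = X.src e' <;> by_cases b : X.tgt e = X.tgt e'
      · exact absurd ⟨e, e', hee, hl, a, b⟩ h2
      · exact Or.inl ⟨a, b⟩
      · exact Or.inr ⟨b, a⟩
      · tauto
    obtain ⟨Y, f, a1, a2, a3, a4, a5⟩ := fold1 X e e' hl this
    obtain ⟨Z, g, b1, b2, b3, b4, b5, b6⟩ := ih _ (by omega) Y rfl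
    exact ⟨Z, g ∘ f, b1.comp a1, b2 ∘ a2, b3 ∘ a3, by omega, by omega, b6⟩

theorem red_of_par (X : MG x φ) (hG : X.Gen) (hc : Nat.card X.E + 1 = Nat.card X.V + n)
    (hp : X.Par) : Red φ := by
  obtain ⟨e, e', hne, hl, hs, ht⟩ := hp
  refine red_of_parallel φ X.V X.E X.src X.tgt X.val hG.2 hc e e' hne hs ht ?_
  rw [X.compat, X.compat, hl, hs, ht]

/-! ### Permutation action -/

theorem exists_perm (X : MG x φ) (hF : X.Folded) (i : L) :
    ∃ σ : Equiv.Perm X.V, ∀ e, X.lab e = i → σ (X.src e) = X.tgt e := by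
  classical
  have := Fintype.ofFinite X.V
  let f : X.V → X.V := fun v =>
    if h : ∃ e, X.lab e = i ∧ X.src e = v then X.tgt h.choose else v
  have hf : ∀ e, X.lab e = i → f (X.src e) = X.tgt e := by
    intro e he
    have h : ∃ e', X.lab e' = i ∧ X.src e' = X.src e := ⟨e, he, rfl⟩
    simp only [f, h, dite_true]
    congr 1
    exact hF _ _ (h.choose_spec.1.trans he.symm) (Or.inl h.choose_spec.2)
  obtain ⟨g, hg⟩ := Set.MapsTo.exists_equiv_extend_of_card_eq (α := X.V) (β := X.V)
    (t := Finset.univ) (s := {v | ∃ e, X.lab e = i ∧ X.src e = v}) (f := f)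
    (by simp) (by intro _ _; simp) (by
      rintro _ ⟨e, he, rfl⟩ _ ⟨e', he', rfl⟩ h
      rw [hf e he, hf e' he'] at h
      rw [hF e e' (he.trans he'.symm) (Or.inr h)])
  refine ⟨g.trans (Equiv.subtypeUnivEquiv (by simp)), fun e he => ?_⟩
  rw [← hf e he, ← hg _ ⟨e, he, rfl⟩]
  rfl

theorem perm_action (X : MG x φ) (hF : X.Folded) {H : Type} [Group H] (a : X.E → H) :
    ∃ Φ : FreeGroup L →* Equiv.Perm (X.V × H), ∀ u v w h,
      Conn X.src X.tgt (fun e => (FreeGroup.of (X.lab e), a e)) u v (w, h) →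
      ∀ h₀, (Φ w) (v, h₀ * h) = (u, h₀) := by
  classical
  choose σ hσ using X.exists_perm hF
  let c : L → X.V → H := fun i v =>
    if h : ∃ e, X.lab e = i ∧ X.src e = v then a h.choose else 1
  have hc : ∀ e, c (X.lab e) (X.src e) = a e := by
    intro e
    have h : ∃ e', X.lab e' = X.lab e ∧ X.src e' = X.src e := ⟨e, rfl, rfl⟩
    simp only [c, h, dite_true]
    congr 1
    exact hF _ _ h.choose_spec.1 (Or.inl h.choose_spec.2)
  let τ : L → Equiv.Perm (X.V × H) := fun i =>
    { toFun := fun p => ((σ i).symm p.1, p.2 * (c i ((σ i).symm p.1))⁻¹)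
      invFun := fun p => (σ i p.1, p.2 * c i p.1)
      left_inv := fun p => by simp
      right_inv := fun p => by simp }
  have hτ : ∀ e h₀, τ (X.lab e) (X.tgt e, h₀ * a e) = (X.src e, h₀) := by
    intro e h₀
    have : (σ (X.lab e)).symm (X.tgt e) = X.src e := by
      rw [Equiv.symm_apply_eq, hσ _ e rfl]
    simp [τ, this, hc]
  refine ⟨FreeGroup.lift τ, ?_⟩
  suffices ∀ u v p, Conn X.src X.tgt (fun e => (FreeGroup.of (X.lab e), a e)) u v p →
      ∀ h₀, (FreeGroup.lift τ p.1) (v, h₀ * p.2) = (u, h₀) from fun u v w h hh => this u v _ hh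
  intro u v p hp
  induction hp with
  | refl => simp
  | fwd e _ ih =>
    intro h₀
    simp only [Prod.fst_mul, Prod.snd_mul, map_mul, FreeGroup.lift_apply_of, Equiv.Perm.mul_apply]
    rw [← mul_assoc, hτ, ih]
  | bwd e _ ih =>
    intro h₀
    simp only [Prod.fst_mul, Prod.snd_mul, map_mul, map_inv, Prod.fst_inv, Prod.snd_inv,
      FreeGroup.lift_apply_of, Equiv.Perm.mul_apply]
    rw [← ih h₀]
    congr 1
    rw [Equiv.Perm.inv_eq_iff_eq]
    rw [← hτ e (h₀ * (_ * (a e)⁻¹))]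
    simp [mul_assoc]

end MG
end NSG

namespace NSG
namespace MG

variable {n : ℕ} {L G : Type} [Group G] {x : L → G} {φ : FreeGroup (Fin n) →* G}

/-- add a new vertex joined to `v` by an edge labelled `l` (outgoing from `v` if `b`) -/
def hair (X : MG x φ) (v : X.V) (l : L) (b : Bool) : MG x φ where
  V := Option X.V
  E := Option X.E
  finV := inferInstance
  finE := inferInstance
  src o := o.elim (bif b then some v else none) (fun e => some (X.src e))
  tgt o := o.elim (bif b then none else some v) (fun e => some (X.tgt e))
  lab o := o.elim l X.lab
  val o := o.elim 1 X.val
  pot o := o.elim (bif b then X.pot v * x l else X.pot v * (x l)⁻¹) X.pot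
  compat o := by
    cases o with
    | some e => exact X.compat e
    | none => cases b <;> simp

theorem hair_hom (X : MG x φ) (v : X.V) (l : L) (b : Bool) : Hom X (X.hair v l b) some :=
  fun e => ⟨some e, rfl, rfl, rfl⟩

theorem hair_genS (X : MG x φ) (v : X.V) (l : L) (b : Bool) {S : Subgroup (FreeGroup (Fin n))}
    (hX : X.GenS S) : (X.hair v l b).GenS S := by
  refine ⟨⟨none⟩, ?_⟩
  have old : ∀ q ∈ S, ∀ u v', Conn (X.hair v l b).src (X.hair v l b).tgt (X.hair v l b).val
      (some u) (some v') q := by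
    intro q hq u v'
    exact (hX.2 q hq u v').map' (V' := Option X.V) some (MonoidHom.id _)
      (fun e => Conn.edge (src := (X.hair v l b).src) (tgt := (X.hair v l b).tgt)
        (a := (X.hair v l b).val) (some e))
  have new : Conn (X.hair v l b).src (X.hair v l b).tgt (X.hair v l b).val none (some v) 1 := by
    cases b
    · exact Conn.edge (src := (X.hair v l false).src) (tgt := (X.hair v l false).tgt)
        (a := (X.hair v l false).val) none
    · exact (Conn.edge' (src := (X.hair v l true).src) (tgt := (X.hair v l true).tgt)
        (a := (X.hair v l true).val) none).cast rfl rfl (inv_one)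
  have all : ∀ u : Option X.V, ∃ v', Conn (X.hair v l b).src (X.hair v l b).tgt (X.hair v l b).val
      u (some v') 1 := by
    intro u
    cases u with
    | none => exact ⟨v, new⟩
    | some u => exact ⟨u, Conn.refl _⟩
  intro q hq (u : Option X.V) (w : Option X.V)
  obtain ⟨u', hu⟩ := all u
  obtain ⟨w', hw⟩ := all w
  exact ((hu.trans (old q hq u' w')).trans hw.symm).cast rfl rfl (by simp)

theorem hair_sol (X : MG x φ) (v : X.V) (l : L) (b : Bool) {Q : Type} [Group Q]
    (α : Option X.E → Q) (hX : X.Sol (fun e => α (some e))) : (X.hair v l b).Sol α := by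
  obtain ⟨χ, β, h⟩ := hX
  refine ⟨χ, fun o => o.elim (bif b then (α none)⁻¹ * β v else α none * β v) β, fun o => ?_⟩
  cases o with
  | some e => exact h e
  | none => cases b <;> simp [hair]

/-- add a new edge -/
def addEdge (X : MG x φ) (s t : X.V) (l : L) (q : FreeGroup (Fin n))
    (h : φ q = X.pot s * x l * (X.pot t)⁻¹) : MG x φ where
  V := X.V
  E := Option X.E
  finV := inferInstance
  finE := inferInstance
  src o := o.elim s X.src
  tgt o := o.elim t X.tgt
  lab o := o.elim l X.lab
  val o := o.elim q X.val
  pot := X.pot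
  compat o := by
    cases o with
    | some e => exact X.compat e
    | none => exact h

theorem addEdge_conn (X : MG x φ) (s t : X.V) (l : L) (q : FreeGroup (Fin n))
    (h : φ q = X.pot s * x l * (X.pot t)⁻¹) {u v : X.V} {p : FreeGroup (Fin n)}
    (hc : Conn X.src X.tgt X.val u v p) :
    Conn (X.addEdge s t l q h).src (X.addEdge s t l q h).tgt (X.addEdge s t l q h).val u v p :=
  hc.map' (V' := X.V) id (MonoidHom.id _)
    (fun e => Conn.edge (src := (X.addEdge s t l q h).src) (tgt := (X.addEdge s t l q h).tgt)
        (a := (X.addEdge s t l q h).val) (some e))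

/-- invariant of the inductive construction of the initial graph -/
def InitP (S : Subgroup (FreeGroup (Fin n))) (c : ℕ) (X : MG x φ) : Prop :=
  (∃ v, X.pot v = 1) ∧ X.GenS S ∧ X.U0 ∧ (∀ e, X.val e ∈ S) ∧
    Nat.card X.E + 1 = Nat.card X.V + c

theorem InitP.hair {S : Subgroup (FreeGroup (Fin n))} {c : ℕ} {X : MG x φ} (hX : InitP S c X)
    (v : X.V) (l : L) (b : Bool) : InitP S c (X.hair v l b) := by
  obtain ⟨⟨v0, h0⟩, h1, h2, h3, h4⟩ := hX
  refine ⟨⟨some v0, h0⟩, X.hair_genS v l b h1, fun Q _ α => hair_sol X v l b α (h2 _ _), ?_, ?_⟩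
  · rintro (_ | e)
    · exact one_mem _
    · exact h3 e
  · have e1 : Nat.card (X.hair v l b).E = Nat.card X.E + 1 := Finite.card_option
    have e2 : Nat.card (X.hair v l b).V = Nat.card X.V + 1 := Finite.card_option
    omega

theorem InitP.reach (hx : Subgroup.closure (Set.range x) = ⊤) {S : Subgroup (FreeGroup (Fin n))}
    {c : ℕ} {X : MG x φ} (hX : InitP S c X) (g : G) :
    ∃ Y : MG x φ, InitP S c Y ∧ ∃ v, Y.pot v = g := by
  have hg : g ∈ Subgroup.closure (Set.range x) := by rw [hx]; trivial
  induction hg using Subgroup.closure_induction_right with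
  | one => exact ⟨X, hX, hX.1⟩
  | mul_right g _ y hy ih =>
    obtain ⟨Y, hY, v, rfl⟩ := ih
    obtain ⟨l, rfl⟩ := hy
    exact ⟨_, hY.hair v l true, none, rfl⟩
  | mul_inv_cancel g _ y hy ih =>
    obtain ⟨Y, hY, v, rfl⟩ := ih
    obtain ⟨l, rfl⟩ := hy
    exact ⟨_, hY.hair v l false, none, rfl⟩

theorem initial_aux (hx : Subgroup.closure (Set.range x) = ⊤) [hL : Nonempty L]
    (T : Finset (Fin n)) : ∃ X : MG x φ,
      InitP (Subgroup.closure (FreeGroup.of '' (T : Set (Fin n)))) T.card X := by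
  classical
  induction T using Finset.induction_on with
  | empty =>
    let X : MG x φ :=
      { V := Unit, E := Empty, finV := inferInstance, finE := inferInstance,
        src := Empty.elim, tgt := Empty.elim, lab := Empty.elim, val := Empty.elim,
        pot := fun _ => 1, compat := fun e => e.elim }
    refine ⟨X, ⟨(), rfl⟩, ⟨⟨()⟩, ?_⟩, fun Q _ α => ⟨1, fun _ => 1, fun e => e.elim⟩,
      fun e => e.elim, by simp [X]⟩
    intro q hq u v
    have : q = 1 := by simpa using hq
    subst this
    exact Conn.refl _
  | insert j T hj ih =>
    obtain ⟨X₀, hX₀⟩ := ih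
    obtain ⟨l⟩ := hL
    obtain ⟨X, hX, v, hv⟩ := hX₀.reach hx (φ (FreeGroup.of j) * (x l)⁻¹)
    obtain ⟨⟨v0, h0⟩, h1, h2, h3, h4⟩ := hX
    let Y := X.addEdge v v0 l (FreeGroup.of j) (by simp [hv, h0])
    have mono : Subgroup.closure (FreeGroup.of '' (T : Set (Fin n))) ≤
        Subgroup.closure (FreeGroup.of '' ((insert j T : Finset (Fin n)) : Set (Fin n))) := by
      apply Subgroup.closure_mono
      apply Set.image_mono
      simp
    refine ⟨Y, ⟨v0, h0⟩, ⟨h1.1, ?_⟩, ?_, ?_, ?_⟩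
    · intro q hq
      induction hq using Subgroup.closure_induction with
      | mem y hy =>
        obtain ⟨i, hi, rfl⟩ := hy
        intro (u : X.V) (w : X.V)
        by_cases hij : i = j
        · subst hij
          have a1 := X.addEdge_conn v v0 l (FreeGroup.of i) (by simp [hv, h0])
            (h1.2 1 (one_mem _) u v)
          have a2 := X.addEdge_conn v v0 l (FreeGroup.of i) (by simp [hv, h0])
            (h1.2 1 (one_mem _) v0 w)
          have a3 : Conn Y.src Y.tgt Y.val v v0 (FreeGroup.of i) :=
            Conn.edge (src := Y.src) (tgt := Y.tgt) (a := Y.val) none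
          exact ((a1.trans a3).trans a2).cast rfl rfl (by simp)
        · refine X.addEdge_conn v v0 l (FreeGroup.of j) (by simp [hv, h0]) (h1.2 _ ?_ u w)
          apply Subgroup.subset_closure
          refine ⟨i, ?_, rfl⟩
          simpa [hij] using hi
      | one => intro u w; exact X.addEdge_conn _ _ _ _ _ (h1.2 1 (one_mem _) u w)
      | mul a b _ _ iha ihb => intro u w; exact (iha u u).trans (ihb u w)
      | inv a _ iha => intro u w; exact (iha w u).symm
    · intro Q _ α
      obtain ⟨χ, β, hχ⟩ := h2 Q (fun e => α (some e))
      let χ' : FreeGroup (Fin n) →* Q := FreeGroup.lift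
        (fun i => if i = j then (β v)⁻¹ * α none * β v0 else χ (FreeGroup.of i))
      have agree : ∀ q ∈ Subgroup.closure (FreeGroup.of '' (T : Set (Fin n))), χ' q = χ q := by
        intro q hq
        refine MonoidHom.eqOn_closure (f := χ') (g := χ) ?_ hq
        rintro _ ⟨i, hi, rfl⟩
        have : i ≠ j := by rintro rfl; exact hj hi
        simp [χ', this]
      refine ⟨χ', β, fun o => ?_⟩
      cases o with
      | none => simp [Y, addEdge, χ', mul_assoc]
      | some e =>
        refine (hχ e).trans ?_
        change _ = β (X.src e) * χ' (X.val e) * (β (X.tgt e))⁻¹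
        rw [agree _ (h3 e)]
    · rintro (_ | e)
      · apply Subgroup.subset_closure
        exact ⟨j, by simp, rfl⟩
      · exact mono (h3 e)
    · have e1 : Nat.card Y.E = Nat.card X.E + 1 := Finite.card_option
      have e2 : Nat.card Y.V = Nat.card X.V := rfl
      rw [Finset.card_insert_of_notMem hj]
      omega

theorem initial (φ : FreeGroup (Fin n) →* G) (hx : Subgroup.closure (Set.range x) = ⊤)
    [hL : Nonempty L] :
    ∃ X : MG x φ, X.Gen ∧ X.U0 ∧ Nat.card X.E + 1 = Nat.card X.V + n := by
  obtain ⟨X, _, h1, h2, _, h4⟩ := initial_aux (φ := φ) hx Finset.univ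
  refine ⟨X, ⟨h1.1, fun u v q => h1.2 q ?_ u v⟩, h2, by simpa using h4⟩
  simp [FreeGroup.closure_range_of]

end MG

/-- A homomorphism between free groups is injective or reducible. -/
theorem inj_or_red {n : ℕ} {L : Type} (χ : FreeGroup (Fin n) →* FreeGroup L) :
    Function.Injective χ ∨ Red χ := by
  rcases isEmpty_or_nonempty L with hL | hL
  · rcases n with _ | n
    · left; intro a b _; exact Subsingleton.elim _ _
    · right
      exact ⟨FreeGroup.of, FreeGroup.closure_range_of _, 0, Subsingleton.elim _ _⟩
  · obtain ⟨X, hG, -, hc⟩ := MG.initial (x := FreeGroup.of) χ (FreeGroup.closure_range_of L)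
    obtain ⟨Y, f, -, h1, -, -, h2, h3⟩ := MG.fold _ X rfl
    have hY := h1 hG
    rcases h3 with h3 | h3
    · left
      rw [injective_iff_map_eq_one]
      intro q hq
      obtain ⟨⟨u⟩, hcn⟩ := hY
      obtain ⟨w, hw⟩ := (hcn u u q).lift (fun e => FreeGroup.of (Y.lab e))
      have e1 := hw.hom_eq (χ.comp (MonoidHom.snd _ _)) (MonoidHom.fst _ _) Y.pot Y.compat
      have e2 : w = 1 := by
        simp only [MonoidHom.comp_apply, MonoidHom.coe_snd, MonoidHom.coe_fst, hq] at e1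
        rw [eq_comm, conj_eq_one_iff] at e1
        exact e1
      subst e2
      obtain ⟨Φ, hΦ⟩ := Y.perm_action h3 Y.val
      have := hΦ _ _ _ _ hw 1
      simpa using this
    · right
      exact Y.red_of_par hY (by omega) h3

/-- homomorphisms to `ZMod 2` detect the number of generators -/
theorem card_gen {H : Type} [Group H] {k m : ℕ} (x : Fin k → H)
    (hx : ∀ c : Fin k → Multiplicative (ZMod 2), ∃ f : H →* Multiplicative (ZMod 2),
      ∀ i, f (x i) = c i)
    (I : Type) [Finite I] (hI : Nat.card I = m) (y : I → H)
    (hy : Subgroup.closure (Set.range y) = ⊤) : k ≤ m := by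
  classical
  choose F hF using hx
  have hinj : Function.Injective (fun (c : Fin k → Multiplicative (ZMod 2)) (i : I) => F c (y i)) := by
    intro c d h
    have : F c = F d := by
      refine MonoidHom.eq_of_eqOn_dense hy ?_
      rintro _ ⟨i, rfl⟩
      exact congrFun h i
    funext i
    rw [← hF c, ← hF d, this]
  have := Fintype.ofFinite I
  have h2 : Nat.card (Fin k → Multiplicative (ZMod 2)) ≤ Nat.card (I → Multiplicative (ZMod 2)) :=
    Nat.card_le_card_of_injective _ hinj
  have h3 : Nat.card (Multiplicative (ZMod 2)) = 2 := by
    rw [Nat.card_congr Multiplicative.toAdd, Nat.card_zmod]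
  rw [Nat.card_fun, Nat.card_fun, hI, h3, Nat.card_fin] at h2
  exact (Nat.pow_le_pow_iff_right (by norm_num)).1 h2

theorem red_card {n k : ℕ} {H : Type} [Group H] (φ : FreeGroup (Fin n) →* H)
    (hφ : Function.Surjective φ) (hR : Red φ) (x : Fin k → H)
    (hx : ∀ c : Fin k → Multiplicative (ZMod 2), ∃ f : H →* Multiplicative (ZMod 2),
      ∀ i, f (x i) = c i) : k + 1 ≤ n := by
  obtain ⟨y, hy, j, hj⟩ := hR
  have hn : Nat.card {i : Fin n // i ≠ j} + 1 = n := by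
    rw [card_ne, Nat.card_fin]
  have : k ≤ Nat.card {i : Fin n // i ≠ j} := by
    refine card_gen x hx {i : Fin n // i ≠ j} rfl (fun i => φ (y i)) ?_
    have h1 : (Subgroup.closure (Set.range y)).map φ = ⊤ := by
      rw [hy, ← MonoidHom.range_eq_map, MonoidHom.range_eq_top.2 hφ]
    rw [← h1, MonoidHom.map_closure]
    apply le_antisymm
    · apply Subgroup.closure_mono
      rintro _ ⟨i, rfl⟩
      exact ⟨_, ⟨i, rfl⟩, rfl⟩
    · rw [Subgroup.closure_le]
      rintro _ ⟨_, ⟨i, rfl⟩, rfl⟩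
      by_cases hi : i = j
      · subst hi; rw [hj]; exact one_mem _
      · exact Subgroup.subset_closure ⟨⟨i, hi⟩, rfl⟩
  omega

/-- free groups are Hopfian -/
theorem hopf {n : ℕ} (θ : FreeGroup (Fin n) →* FreeGroup (Fin n)) (h : Function.Surjective θ) :
    Function.Injective θ := by
  rcases inj_or_red θ with h1 | h1
  · exact h1
  · have := red_card θ h h1 FreeGroup.of (fun c => ⟨FreeGroup.lift c, by simp⟩)
    omega

namespace MG

variable {n : ℕ} {L G : Type} [Group G] {x : L → G} {φ : FreeGroup (Fin n) →* G}

theorem key (hR : ¬ Red φ) (X : MG x φ) (hG : X.Gen) {M : Type} (α : X.E → FreeGroup M)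
    (η : FreeGroup M →* G) (hη : ∀ e, η (α e) = x (X.lab e))
    (χ : FreeGroup (Fin n) →* FreeGroup M) (β : X.V → FreeGroup M)
    (hα : ∀ e, α e = β (X.src e) * χ (X.val e) * (β (X.tgt e))⁻¹) : Function.Injective χ := by
  rcases inj_or_red χ with h | ⟨y, hy, j, hj⟩
  · exact h
  · exfalso
    apply hR
    refine ⟨y, hy, j, ?_⟩
    obtain ⟨⟨u⟩, hc⟩ := hG
    have := (hc u u (y j)).hom_eq φ (η.comp χ) (fun v => X.pot v * η (β v)) (by
      intro e
      rw [X.compat, ← hη, hα]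
      simp [mul_assoc])
    rw [this]
    simp [hj]

theorem not_par (hR : ¬ Red φ) (X : MG x φ) (hG : X.Gen) (hU : X.U0) : ¬ X.Par := by
  classical
  rintro ⟨e, e', hne, hl, hs, ht⟩
  have hv : X.val e = X.val e' := by
    obtain ⟨χ, β, h⟩ := hU (FreeGroup X.E)
      (fun c => if c = e' then FreeGroup.of e else FreeGroup.of c)
    have hi := key hR X hG _ (FreeGroup.lift (fun c => x (X.lab c))) (by
      intro c
      by_cases hc : c = e'
      · simp [hc, hl]
      · simp [hc]) χ β h
    apply hi
    have h1 := h e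
    have h2 := h e'
    simp only [hne, if_true, if_false] at h1 h2
    rw [h1, hs, ht] at h2
    exact mul_left_cancel (mul_right_cancel h2)
  obtain ⟨χ, β, h⟩ := hU (FreeGroup X.E) FreeGroup.of
  apply hne
  apply FreeGroup.of_injective
  rw [h e, h e', hs, ht, hv]

theorem foldStar (hR : ¬ Red φ) (X : MG x φ) (hG : X.Gen) (hU : X.U0) :
    ∃ (Y : MG x φ) (f : X.V → Y.V), Hom X Y f ∧ Y.Folded ∧ Y.Gen ∧ Y.U0 ∧
      Nat.card Y.V ≤ Nat.card X.V := by
  obtain ⟨Y, f, h0, h1, h2, h3, -, h4⟩ := fold _ X rfl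
  rcases h4 with h4 | h4
  · exact ⟨Y, f, h0, h4, h1 hG, h2 hU, h3⟩
  · exact absurd h4 (not_par hR Y (h1 hG) (h2 hU))

end MG
end NSG

namespace NSG

/-! ### Phases -/

/-- cyclic phases of the relator -/
abbrev Ph (k : ℕ) := Fin k × Bool

section phases

variable {k : ℕ} [NeZero k]

/-- next phase -/
def nx (j : Ph k) : Ph k := bif j.2 then (j.1 + 1, false) else (j.1, true)

/-- previous phase -/
def pv (j : Ph k) : Ph k := bif j.2 then (j.1, false) else (j.1 - 1, true)

theorem nx_pv (j : Ph k) : nx (pv j) = j := by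
  obtain ⟨i, _ | _⟩ := j <;> simp [nx, pv]

theorem pv_nx (j : Ph k) : pv (nx j) = j := by
  obtain ⟨i, _ | _⟩ := j <;> simp [nx, pv]

theorem nx_inj {j j' : Ph k} (h : nx j = nx j') : j = j' := by
  rw [← pv_nx j, h, pv_nx]

open Fin.NatCast in
theorem nx_even (m : ℕ) (i : Fin k) (b : Bool) : nx^[2 * m] (i, b) = (i + (m : Fin k), b) := by
  induction m generalizing i b with
  | zero => simp
  | succ m ih =>
    have : nx (nx (i, b)) = (i + 1, b) := by cases b <;> simp [nx]
    rw [Nat.mul_succ, Function.iterate_add_apply]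
    simp only [Function.iterate_succ, Function.iterate_zero, Function.comp, id]
    rw [this, ih]
    push_cast
    congr 1
    rw [add_assoc, add_comm 1]

theorem nx_period (j : Ph k) : nx^[2 * k] j = j := by
  obtain ⟨i, b⟩ := j
  rw [nx_even]; simp

theorem nx_ne (j : Ph k) (s : ℕ) (h0 : 0 < s) (h1 : s < 2 * k) : nx^[s] j ≠ j := by
  obtain ⟨i, b⟩ := j
  rcases Nat.even_or_odd' s with ⟨m, rfl | rfl⟩
  · rw [nx_even]
    intro h
    have h := congrArg Prod.fst h
    simp only [add_eq_left] at h
    have := congrArg Fin.val h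
    rw [Fin.val_natCast, Nat.mod_eq_of_lt (by omega)] at this
    simp at this
    omega
  · rw [Function.iterate_succ_apply', nx_even]
    intro h
    have h := congrArg Prod.snd h
    cases b <;> simp [nx] at h

open Fin.NatCast in
theorem fin_cyc (P : Fin k → Prop) (h : ∀ i, P i → P (i + 1)) (i j : Fin k) (hi : P i) : P j := by
  have : ∀ m : ℕ, P (nx^[2 * m] ((i, false) : Ph k)).1 := by
    intro m
    induction m with
    | zero => simpa using hi
    | succ m ih =>
      rw [nx_even] at ih ⊢
      have := h _ ih
      simp only [add_assoc] at this
      simpa [Nat.cast_add] using this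
  have h2 := this (j - i).val
  rw [nx_even] at h2
  simpa using h2

theorem ph_cyc (P : Ph k → Prop) (h : ∀ j, P j → P (nx j)) (j j' : Ph k) (hj : P j) : P j' := by
  have h2 : ∀ i b, P (i, b) → P (i + 1, b) := by
    intro i b hb
    have := h _ (h _ hb)
    cases b <;> simpa [nx] using this
  have h3 : ∀ i, P (i, false) → ∀ i', P (i', false) := fun i hi i' =>
    fin_cyc (fun i => P (i, false)) (fun i => h2 i false) i i' hi
  have h0 : ∃ i, P (i, false) := by
    obtain ⟨i, _ | _⟩ := j
    · exact ⟨i, hj⟩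
    · exact ⟨i + 1, by simpa [nx] using h _ hj⟩
  obtain ⟨i, hi⟩ := h0
  obtain ⟨i', _ | _⟩ := j'
  · exact h3 i hi i'
  · simpa [nx] using h _ (h3 i hi i')

theorem ph_cyc_back (P : Ph k → Prop) (h : ∀ j, P (nx j) → P j) (j j' : Ph k) (hj : P j) :
    P j' := by
  by_contra hn
  exact ph_cyc (fun j => ¬ P j) (fun j h1 h2 => h1 (h j h2)) j' j hn hj

variable {H : Type} [Group H]

/-- holonomy along `m` consecutive phases -/
def hol (f : Ph k → H) : Ph k → ℕ → H
  | _, 0 => 1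
  | j, m + 1 => f j * hol f (nx j) m

theorem hol_succ' (f : Ph k → H) (j : Ph k) (m : ℕ) :
    hol f j (m + 1) = hol f j m * f (nx^[m] j) := by
  induction m generalizing j with
  | zero => simp [hol]
  | succ m ih =>
    rw [hol, ih, Function.iterate_succ_apply, ← mul_assoc]; rfl

theorem hol_map {H' : Type} [Group H'] (ψ : H →* H') (f : Ph k → H) (j : Ph k) (m : ℕ) :
    ψ (hol f j m) = hol (fun j => ψ (f j)) j m := by
  induction m generalizing j with
  | zero => simp [hol]
  | succ m ih => simp [hol, ih]

theorem hol_congr (f g : Ph k → H) (j : Ph k) (m : ℕ)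
    (h : ∀ t < m, f (nx^[t] j) = g (nx^[t] j)) : hol f j m = hol g j m := by
  induction m with
  | zero => simp [hol]
  | succ m ih =>
    rw [hol_succ', hol_succ', ih (fun t ht => h t (by omega)), h m (by omega)]

/-- trivial holonomy -/
def Triv (f : Ph k → H) : Prop := ∀ j, hol f j (2 * k) = 1

theorem triv_of (f : Ph k → H) (j : Ph k) (h : hol f j (2 * k) = 1) : Triv f := by
  intro j'
  refine ph_cyc (fun j => hol f j (2 * k) = 1) ?_ j j' h
  intro j hj
  have h1 : hol f j (2 * k + 1) = f j * hol f (nx j) (2 * k) := rfl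
  rw [hol_succ', hj, nx_period, one_mul] at h1
  exact left_eq_mul.1 h1

theorem hol_split (f : Ph k → H) (j : Ph k) :
    hol f j (2 * k) = f j * hol f (nx j) (2 * k - 1) := by
  have : 2 * k = (2 * k - 1) + 1 := by have := NeZero.pos k; omega
  conv_lhs => rw [this]
  rfl

theorem hol_off (f g : Ph k → H) (j : Ph k) (h : ∀ i, i ≠ j → f i = g i) :
    hol f (nx j) (2 * k - 1) = hol g (nx j) (2 * k - 1) := by
  apply hol_congr
  intro t ht
  apply h
  rw [← Function.iterate_succ_apply]
  exact nx_ne j _ (by omega) (by omega)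

theorem triv_det (f g : Ph k → H) (hf : Triv f) (hg : Triv g) (j : Ph k)
    (h : ∀ i, i ≠ j → f i = g i) : f j = g j := by
  have h1 := hf j
  have h2 := hg j
  rw [hol_split] at h1 h2
  rw [hol_off f g j h, ← h2] at h1
  exact mul_right_cancel h1

theorem triv_solve (f : Ph k → H) (j : Ph k) :
    ∃ q, ∀ g : Ph k → H, (∀ i, i ≠ j → f i = g i) → g j = q → Triv g := by
  refine ⟨(hol f (nx j) (2 * k - 1))⁻¹, fun g hg hq => triv_of g j ?_⟩
  rw [hol_split, ← hol_off f g j hg, hq]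
  simp

theorem hol_gauge (a s t : Ph k → H) (jl : Ph k) (hl : ∀ j, j ≠ jl → t j = s (nx j)) :
    hol (fun j => s j * a j * (t j)⁻¹) (nx jl) (2 * k) =
      s (nx jl) * hol a (nx jl) (2 * k) * (t jl)⁻¹ := by
  have key : ∀ m, m + 1 ≤ 2 * k → hol (fun j => s j * a j * (t j)⁻¹) (nx jl) (m + 1) =
      s (nx jl) * hol a (nx jl) (m + 1) * (t (nx^[m] (nx jl)))⁻¹ := by
    intro m
    induction m with
    | zero => intro _; simp [hol]
    | succ m ih =>
      intro hm
      rw [hol_succ', ih (by omega), hol_succ' a _ (m + 1), hl, ← Function.iterate_succ_apply' nx]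
      · simp [mul_assoc]
      · rw [← Function.iterate_succ_apply]
        exact nx_ne _ _ (by omega) (by omega)
  have hk : 2 * k - 1 + 1 = 2 * k := by have := NeZero.pos k; omega
  have := key (2 * k - 1) (by omega)
  rw [hk, ← Function.iterate_succ_apply, Nat.succ_eq_add_one, hk, nx_period] at this
  exact this

theorem hol_conn {V E : Type} {src tgt : E → V} {a : E → H} (s t : Ph k → V) (c : Ph k → H)
    (j : Ph k) (hc : ∀ i, i ≠ j → Conn src tgt a (s i) (t i) (c i)) (hst : ∀ i, t i = s (nx i)) :
    Conn src tgt a (t j) (s j) (hol c (nx j) (2 * k - 1)) := by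
  have key : ∀ m, m + 1 ≤ 2 * k → Conn src tgt a (t j) (s (nx^[m] (nx j))) (hol c (nx j) m) := by
    intro m
    induction m with
    | zero => intro _; simp only [hol, Function.iterate_zero, id, hst]; exact Conn.refl _
    | succ m ih =>
      intro hm
      rw [hol_succ', Function.iterate_succ_apply', ← hst]
      refine (ih (by omega)).trans (hc _ ?_)
      rw [← Function.iterate_succ_apply]
      exact nx_ne _ _ (by omega) (by omega)
  have hk : 2 * k - 1 + 1 = 2 * k := by have := NeZero.pos k; omega
  have := key (2 * k - 1) (by omega)
  rw [← Function.iterate_succ_apply, Nat.succ_eq_add_one, hk, nx_period] at this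
  exact this

open Fin.NatCast in
theorem hol_relator (x : Fin k → H) :
    hol (fun j : Ph k => x j.1) (0, false) (2 * k) = FreeGroup.lift x (nonorientableRelator k) := by
  have key : ∀ m : ℕ, hol (fun j : Ph k => x j.1) (0, false) (2 * m) =
      ((List.range m).map (fun t : ℕ => x (t : Fin k) ^ 2)).prod := by
    intro m
    induction m with
    | zero => simp [hol]
    | succ m ih =>
      rw [Nat.mul_succ, hol_succ', hol_succ', ih, List.prod_range_succ, Function.iterate_succ_apply',
        nx_even]
      simp [nx, pow_two, mul_assoc]
  rw [key, nonorientableRelator, map_list_prod, List.map_map, ← List.map_coe_finRange_eq_range,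
    List.map_map]
  congr 2
  funext i
  simp

end phases
end NSG

set_option linter.unusedSectionVars false

namespace NSG
namespace MG

variable {n k : ℕ} [NeZero k] {G : Type} [Group G] {x : Fin k → G} {φ : FreeGroup (Fin n) →* G}

/-- the label word `w` can be read from `u` to `v` -/
def Reads (X : MG x φ) (u v : X.V) (w : FreeGroup (Fin k)) : Prop :=
  Conn X.src X.tgt (fun e => FreeGroup.of (X.lab e)) u v w

theorem Reads.map {X Y : MG x φ} {f : X.V → Y.V} (hf : Hom X Y f) {u v : X.V}
    {w : FreeGroup (Fin k)} (h : X.Reads u v w) : Y.Reads (f u) (f v) w := by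
  refine Conn.map' f (MonoidHom.id _) (fun e => ?_) h
  obtain ⟨e', h1, h2, h3⟩ := hf e
  exact (Conn.edge e').cast h1 h2 (by simp [h3])

theorem Reads.unique {X : MG x φ} (hF : X.Folded) {u v v' : X.V}
    {w : FreeGroup (Fin k)} (h : X.Reads u v w) (h' : X.Reads u v' w) : v = v' := by
  obtain ⟨Φ, hΦ⟩ := X.perm_action hF (fun _ => (1 : Multiplicative ℤ))
  have up : ∀ v, X.Reads u v w → Conn X.src X.tgt
      (fun e => (FreeGroup.of (X.lab e), (1 : Multiplicative ℤ))) u v (w, 1) := by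
    intro v h
    exact Conn.map' (H' := FreeGroup (Fin k) × Multiplicative ℤ) (src' := X.src) (tgt' := X.tgt)
      (a' := fun e => (FreeGroup.of (X.lab e), (1 : Multiplicative ℤ))) id
      (MonoidHom.prod (MonoidHom.id (FreeGroup (Fin k))) 1) (fun e => Conn.edge e) h
  have h1 := hΦ _ _ _ _ (up v h) 1
  have h2 := hΦ _ _ _ _ (up v' h') 1
  have := (Φ w).injective (h1.trans h2.symm)
  exact congrArg Prod.fst this

/-- some vertex has loops with all labels -/
def IsRose (X : MG x φ) : Prop :=
  ∃ v, ∀ i, ∃ e, X.src e = v ∧ X.tgt e = v ∧ X.lab e = i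

theorem rose (C : MG x φ → Prop) (hC : ∀ X, C X → X.Folded ∧ X.Gen)
    (h1 : ∀ X, C X → ∀ (v : X.V) (i : Fin k) (b : Bool), ∃ (Y : MG x φ) (f : X.V → Y.V), C Y ∧
      Hom X Y f ∧ ∃ e, Y.lab e = i ∧ (bif b then Y.src e else Y.tgt e) = f v)
    (h2 : ∀ X, C X → ∀ v : X.V, ∃ (Y : MG x φ) (f : X.V → Y.V), C Y ∧ Hom X Y f ∧
      Y.Reads (f v) (f v) (nonorientableRelator k))
    (hφ : Function.Surjective φ)
    (hker : ∀ w, FreeGroup.lift x w = 1 → w ∈ Subgroup.normalClosure {nonorientableRelator k})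
    (X : MG x φ) (hX : C X) : ∃ Y : MG x φ, C Y ∧ Y.IsRose := by
  have readable : ∀ (w : FreeGroup (Fin k)) (X : MG x φ), C X → ∀ v : X.V,
      ∃ (Y : MG x φ) (f : X.V → Y.V), C Y ∧ Hom X Y f ∧ ∃ v', Y.Reads (f v) v' w := by
    intro w
    induction w using FreeGroup.induction_on with
    | C1 => exact fun X hX v => ⟨X, id, hX, Hom.id X, v, Conn.refl v⟩
    | of i =>
      intro X hX v
      obtain ⟨Y, f, hY, hf, e, he, hv⟩ := h1 X hX v i true
      refine ⟨Y, f, hY, hf, Y.tgt e, ?_⟩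
      exact (Conn.edge e).cast hv rfl (by simp [he])
    | inv_of i _ =>
      intro X hX v
      obtain ⟨Y, f, hY, hf, e, he, hv⟩ := h1 X hX v i false
      refine ⟨Y, f, hY, hf, Y.src e, ?_⟩
      exact (Conn.edge' e).cast hv rfl (by simp [he])
    | mul a b ha hb =>
      intro X hX v
      obtain ⟨Y, f, hY, hf, v', hv'⟩ := ha X hX v
      obtain ⟨Z, g, hZ, hg, v'', hv''⟩ := hb Y hY v'
      exact ⟨Z, g ∘ f, hZ, hg.comp hf, v'', (hv'.map hg).trans hv''⟩
  let N : Subgroup (FreeGroup (Fin k)) :=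
    { carrier := {w | ∀ X, C X → ∀ v : X.V, ∃ (Y : MG x φ) (f : X.V → Y.V), C Y ∧ Hom X Y f ∧
        Y.Reads (f v) (f v) w}
      one_mem' := fun X hX v => ⟨X, id, hX, Hom.id X, Conn.refl _⟩
      mul_mem' := by
        intro a b ha hb X hX v
        obtain ⟨Y, f, hY, hf, hv⟩ := ha X hX v
        obtain ⟨Z, g, hZ, hg, hv'⟩ := hb Y hY (f v)
        exact ⟨Z, g ∘ f, hZ, hg.comp hf, (hv.map hg).trans hv'⟩
      inv_mem' := by
        intro a ha X hX v
        obtain ⟨Y, f, hY, hf, hv⟩ := ha X hX v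
        exact ⟨Y, f, hY, hf, Conn.symm hv⟩ }
  have hN : N.Normal := by
    constructor
    intro w hw g X hX v
    obtain ⟨Y, f, hY, hf, v', hv'⟩ := readable g X hX v
    obtain ⟨Z, g', hZ, hg, hv⟩ := hw Y hY v'
    exact ⟨Z, g' ∘ f, hZ, hg.comp hf, ((hv'.map hg).trans hv).trans (Conn.symm (hv'.map hg))⟩
  have hle : Subgroup.normalClosure {nonorientableRelator k} ≤ N := by
    apply Subgroup.normalClosure_le_normal
    rintro _ rfl
    exact h2
  have loops : ∀ s : Finset (Fin k), ∃ Y : MG x φ, C Y ∧ ∃ v : Y.V,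
      ∀ i ∈ s, ∃ e, Y.src e = v ∧ Y.tgt e = v ∧ Y.lab e = i := by
    intro s
    induction s using Finset.induction_on with
    | empty =>
      obtain ⟨v⟩ := (hC X hX).2.1
      exact ⟨X, hX, v, by simp⟩
    | insert i s his ih =>
      obtain ⟨Y, hY, v, hv⟩ := ih
      obtain ⟨q, hq⟩ := hφ (Y.pot v * x i * (Y.pot v)⁻¹)
      obtain ⟨w, hw⟩ := ((hC Y hY).2.2 v v q).lift (fun e => FreeGroup.of (Y.lab e))
      have e1 := hw.hom_eq (φ.comp (MonoidHom.snd _ _))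
        ((FreeGroup.lift x).comp (MonoidHom.fst _ _)) Y.pot (by intro e; simp [Y.compat])
      have e2 : x i = FreeGroup.lift x w := by
        simp only [MonoidHom.comp_apply, MonoidHom.coe_snd, MonoidHom.coe_fst, hq] at e1
        exact mul_left_cancel (mul_right_cancel e1)
      have rw1 : Y.Reads v v w := Conn.map' (src' := Y.src) (tgt' := Y.tgt)
        (a' := fun e => FreeGroup.of (Y.lab e)) id
        (MonoidHom.fst (FreeGroup (Fin k)) (FreeGroup (Fin n))) (fun e => Conn.edge e) hw
      have hmem : w⁻¹ * FreeGroup.of i ∈ N := hle (hker _ (by simp [e2]))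
      obtain ⟨Z, f, hZ, hf, hv2⟩ := hmem Y hY v
      have rw2 : Z.Reads (f v) (f v) (FreeGroup.of i) :=
        Conn.cast ((rw1.map hf).trans hv2) rfl rfl (by simp)
      obtain ⟨W, g, hW, hg, e, he, hev⟩ := h1 Z hZ (f v) i true
      have hev : W.src e = g (f v) := hev
      have rw3 : W.Reads (g (f v)) (W.tgt e) (FreeGroup.of i) :=
        (Conn.edge e).cast hev rfl (by simp [he])
      have ht := Reads.unique (hC W hW).1 rw3 (rw2.map hg)
      refine ⟨W, hW, g (f v), fun i' hi' => ?_⟩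
      rcases Finset.mem_insert.1 hi' with rfl | hi'
      · exact ⟨e, hev, ht, he⟩
      · obtain ⟨e, a1, a2, a3⟩ := hv i' hi'
        obtain ⟨e', b1, b2, b3⟩ := (hg.comp hf) e
        exact ⟨e', by simp [b1, a1], by simp [b2, a2], b3.trans a3⟩
  obtain ⟨Y, hY, v, hv⟩ := loops Finset.univ
  exact ⟨Y, hY, v, fun i => hv i (Finset.mem_univ _)⟩

/-! ### Lines and polygons -/

/-- lines of length `2k` whose last phase is `jl` -/
def IsLine (X : MG x φ) (jl : Ph k) (p : Ph k → X.E) : Prop :=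
  (∀ j, X.lab (p j) = j.1) ∧ ∀ j, j ≠ jl → X.tgt (p j) = X.src (p (nx j))

/-- closed polygons -/
def IsPoly (X : MG x φ) (p : Ph k → X.E) : Prop :=
  (∀ j, X.lab (p j) = j.1) ∧ ∀ j, X.tgt (p j) = X.src (p (nx j))

/-- all lines close up -/
def NonBad (X : MG x φ) : Prop := ∀ jl p, X.IsLine jl p → X.IsPoly p

/-- trivial on polygons -/
def TrivCl (X : MG x φ) {Q : Type} [Group Q] (α : X.E → Q) : Prop :=
  ∀ p, X.IsPoly p → Triv (fun j => α (p j))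

/-- universality for functions trivial on polygons -/
def Ucl (X : MG x φ) : Prop :=
  ∀ (Q : Type) [Group Q] (α : X.E → Q), X.TrivCl α → X.Sol α

/-- the class used in the main induction -/
def Cls (X : MG x φ) : Prop := X.Folded ∧ X.Gen ∧ X.Ucl ∧ ¬ X.IsRose

theorem IsPoly.isLine {X : MG x φ} {p : Ph k → X.E} (h : X.IsPoly p) (jl : Ph k) :
    X.IsLine jl p := ⟨h.1, fun j _ => h.2 j⟩

/-- lines agreeing in one phase agree everywhere -/
theorem line_unique {X : MG x φ} (hF : X.Folded) {jl : Ph k} {p q : Ph k → X.E}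
    (hp : X.IsLine jl p) (hq : X.IsLine jl q) (j : Ph k) (h : p j = q j) : p = q := by
  have stepF : ∀ j, j ≠ jl → p j = q j → p (nx j) = q (nx j) := fun j hj h =>
    hF _ _ (by rw [hp.1, hq.1]) (Or.inl (by rw [← hp.2 j hj, ← hq.2 j hj, h]))
  have stepB : ∀ j, j ≠ jl → p (nx j) = q (nx j) → p j = q j := fun j hj h =>
    hF _ _ (by rw [hp.1, hq.1]) (Or.inr (by rw [hp.2 j hj, hq.2 j hj, h]))
  have h0 : p jl = q jl := by
    have := ph_cyc (fun j => p j = q j ∨ p jl = q jl) (by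
      rintro j (h | h)
      · by_cases hj : j = jl
        · subst hj; exact Or.inr h
        · exact Or.inl (stepF j hj h)
      · exact Or.inr h) j jl (Or.inl h)
    tauto
  have hb : ∀ j, p j = q j := by
    intro j
    by_contra hn
    have := ph_cyc (fun j => p j ≠ q j) (by
      intro j hj h'
      by_cases hjl : j = jl
      · subst hjl; exact hj h0
      · exact hj (stepB j hjl h')) j jl hn
    exact this h0
  exact funext hb

/-- the other phase with the same letter -/
def flip (j : Ph k) : Ph k := (j.1, !j.2)

theorem flip_ne (j : Ph k) : flip j ≠ j := by
  intro h
  have := congrArg Prod.snd h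
  simp [flip] at this

theorem eq_or_flip {i j : Ph k} (h : i.1 = j.1) : i = j ∨ i = flip j := by
  obtain ⟨a, _ | _⟩ := i <;> obtain ⟨b, _ | _⟩ := j <;> simp_all [flip]

/-- no free side in a family of polygons forces the rose -/
theorem no_free (hφ : Function.Surjective φ)
    (hker : ∀ w, FreeGroup.lift x w = 1 → w ∈ Subgroup.normalClosure {nonorientableRelator k})
    (X : MG x φ) (hF : X.Folded) (hG : X.Gen) (P : Set (Ph k → X.E)) (hne : P.Nonempty)
    (hP : ∀ p ∈ P, X.IsPoly p) (hfl : ∀ p ∈ P, ∀ j, ∃ q ∈ P, q (flip j) = p j) : X.IsRose := by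
  let O : X.V → Ph k → Prop := fun v j => ∃ p ∈ P, X.src (p j) = v
  have o1 : ∀ v i, O v (i, false) → O v (i, true) := by
    rintro v i ⟨p, hp, rfl⟩
    obtain ⟨q, hq, h⟩ := hfl p hp (i, false)
    exact ⟨q, hq, congrArg X.src h⟩
  have o2 : ∀ v i, O v (i, true) → O v (i + 1, false) := by
    rintro v i ⟨p, hp, rfl⟩
    obtain ⟨q, hq, h⟩ := hfl p hp (i, false)
    refine ⟨q, hq, ?_⟩
    have a1 := (hP q hq).2 (i, true)
    have a2 := (hP p hp).2 (i, false)
    have h : q (i, true) = p (i, false) := h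
    rw [h] at a1
    exact (a1.symm.trans a2)
  have o3 : ∀ v j, O v j → ∀ j', O v j' := by
    intro v j h j'
    refine ph_cyc (O v) ?_ j j' h
    rintro ⟨i, _ | _⟩ h
    · exact o1 v i h
    · exact o2 v i h
  have hstart : ∃ v, ∀ j, O v j := by
    obtain ⟨p, hp⟩ := hne
    exact ⟨_, o3 _ (0, false) ⟨p, hp, rfl⟩⟩
  obtain ⟨v0, hv0⟩ := hstart
  have inn : ∀ v, (∀ j, O v j) → ∀ j, ∃ p ∈ P, X.tgt (p j) = v := by
    intro v hv j
    obtain ⟨p, hp, h⟩ := hv (nx j)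
    exact ⟨p, hp, ((hP p hp).2 j).trans h⟩
  have hall : ∀ v j, O v j := by
    intro v
    refine (hG.2 v0 v 1).closed (fun v => ∀ j, O v j) ?_ ?_ hv0
    · intro e he
      obtain ⟨p, hp, h⟩ := he (X.lab e, false)
      have : p (X.lab e, false) = e := hF _ _ ((hP p hp).1 _) (Or.inl h)
      apply o3 _ (nx (X.lab e, false))
      exact ⟨p, hp, by rw [← (hP p hp).2, this]⟩
    · intro e he
      obtain ⟨p, hp, h⟩ := inn _ he (X.lab e, false)
      have : p (X.lab e, false) = e := hF _ _ ((hP p hp).1 _) (Or.inr h)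
      apply o3 _ (X.lab e, false)
      exact ⟨p, hp, by rw [this]⟩
  obtain ⟨Y, rfl, hY⟩ := rose (fun Y => Y = X) (by rintro _ rfl; exact ⟨hF, hG⟩) (by
    rintro _ rfl v i b
    refine ⟨_, id, rfl, Hom.id _, ?_⟩
    cases b
    · obtain ⟨p, hp, h⟩ := inn v (hall v) (i, false)
      exact ⟨_, (hP p hp).1 _, h⟩
    · obtain ⟨p, hp, h⟩ := hall v (i, false)
      exact ⟨_, (hP p hp).1 _, h⟩) (by
    rintro Y rfl v
    refine ⟨_, id, rfl, Hom.id _, ?_⟩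
    obtain ⟨p, hp, h⟩ := hall v (0, false)
    have hl := hP p hp
    have hc := hol_conn (src := Y.src) (tgt := Y.tgt) (a := fun e => FreeGroup.of (Y.lab e))
      (fun j => Y.src (p j)) (fun j => Y.tgt (p j)) (fun j => FreeGroup.of (Y.lab (p j)))
      (0, false) (fun i _ => Conn.edge (p i)) hl.2
    have hc2 := (Conn.edge (src := Y.src) (tgt := Y.tgt) (a := fun e => FreeGroup.of (Y.lab e))
      (p (0, false))).trans hc
    refine hc2.cast h h ?_
    have := hol_split (fun j => FreeGroup.of (Y.lab (p j))) (0, false)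
    rw [← this]
    simp only [hl.1]
    rw [hol_relator]
    exact FreeGroup.lift_of_apply _) hφ hker X rfl
  exact hY

/-- free sides in families of polygons -/
theorem free_side (hφ : Function.Surjective φ)
    (hker : ∀ w, FreeGroup.lift x w = 1 → w ∈ Subgroup.normalClosure {nonorientableRelator k})
    (X : MG x φ) (hX : X.Cls) (P : Set (Ph k → X.E)) (hne : P.Nonempty)
    (hP : ∀ p ∈ P, X.IsPoly p) : ∃ p ∈ P, ∃ j, ∀ q ∈ P, ∀ i, q i = p j → q = p ∧ i = j := by
  by_contra hcon
  push Not at hcon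
  refine hX.2.2.2 (no_free hφ hker X hX.1 hX.2.1 P hne hP fun p hp j => ?_)
  obtain ⟨q, hq, i, h1, h2⟩ := hcon p hp j
  have hl : i.1 = j.1 := by rw [← (hP q hq).1, ← (hP p hp).1, h1]
  rcases eq_or_flip hl with rfl | rfl
  · exact absurd rfl (h2 (line_unique hX.1 ((hP q hq).isLine i) ((hP p hp).isLine i) i h1))
  · exact ⟨q, hq, h1⟩

/-- free sides in families of polygons together with one bad line -/
theorem free_side' (hφ : Function.Surjective φ)
    (hker : ∀ w, FreeGroup.lift x w = 1 → w ∈ Subgroup.normalClosure {nonorientableRelator k})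
    (X : MG x φ) (hX : X.Cls) (jl : Ph k) (r : Ph k → X.E) (hr : X.IsLine jl r)
    (hr' : X.tgt (r jl) ≠ X.src (r (nx jl))) (P : Set (Ph k → X.E)) (hne : P.Nonempty)
    (hP : ∀ p ∈ P, X.IsPoly p ∨ p = r) :
    ∃ p ∈ P, ∃ j, ∀ q ∈ P, ∀ i, q i = p j → q = p ∧ i = j := by
  by_cases hrP : r ∈ P
  swap
  · refine free_side hφ hker X hX P hne fun p hp => ?_
    rcases hP p hp with h | rfl
    · exact h
    · exact absurd hp hrP
  by_contra hcon
  push Not at hcon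
  have hline : ∀ p ∈ P, X.IsLine jl p := by
    intro p hp
    rcases hP p hp with h | rfl
    · exact h.isLine jl
    · exact hr
  have hfl : ∀ p ∈ P, ∀ j, ∃ q ∈ P, q (flip j) = p j := by
    intro p hp j
    obtain ⟨q, hq, i, h1, h2⟩ := hcon p hp j
    have hl : i.1 = j.1 := by rw [← (hline q hq).1, ← (hline p hp).1, h1]
    rcases eq_or_flip hl with rfl | rfl
    · exact absurd rfl (h2 (line_unique hX.1 (hline q hq) (hline p hp) i h1))
    · exact ⟨q, hq, h1⟩
  let u := X.src (r (nx jl))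
  let O : Ph k → Prop := fun j => ∃ p ∈ P, X.src (p j) = u
  let I : Ph k → Prop := fun j => ∃ p ∈ P, X.tgt (p (pv j)) = u
  have o1 : ∀ j, O j → O (flip j) := by
    rintro j ⟨p, hp, h⟩
    obtain ⟨q, hq, h'⟩ := hfl p hp j
    exact ⟨q, hq, by rw [h', h]⟩
  have i1 : ∀ j, I j → I (nx (flip (pv j))) := by
    rintro j ⟨p, hp, h⟩
    obtain ⟨q, hq, h'⟩ := hfl p hp (pv j)
    exact ⟨q, hq, by rw [pv_nx, h', h]⟩
  have noI : ¬ I (nx jl) := by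
    rintro ⟨p, hp, h⟩
    rw [pv_nx] at h
    rcases hP p hp with h1 | rfl
    · have h2 := h1.2 jl
      have h3 : p (nx jl) = r (nx jl) :=
        hX.1 _ _ (by rw [h1.1, hr.1]) (Or.inl (by rw [← h2, h]))
      have := line_unique hX.1 (h1.isLine jl) hr _ h3
      subst this
      exact hr' h2
    · exact hr' h
  have thr : ∀ j, j ≠ nx jl → (O j ↔ I j) := by
    intro j hj
    have hj' : pv j ≠ jl := by rintro rfl; exact hj (nx_pv j).symm
    constructor
    · rintro ⟨p, hp, h⟩
      refine ⟨p, hp, ?_⟩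
      rw [(hline p hp).2 _ hj', nx_pv, h]
    · rintro ⟨p, hp, h⟩
      refine ⟨p, hp, ?_⟩
      rw [(hline p hp).2 _ hj', nx_pv] at h
      exact h
  have hO : O (nx jl) := ⟨r, hrP, rfl⟩
  -- go around the vertex
  have step : ∀ j, j.2 = (nx jl).2 → O j → I (nx (flip (pv (flip j)))) := by
    intro j hj h
    refine i1 _ ((thr _ ?_).1 (o1 _ h))
    intro h'
    rw [← h'] at hj
    simp [flip] at hj
  have step' : ∀ j, j.2 = (nx jl).2 → O j → O (nx (flip (pv (flip j)))) := by
    intro j hj h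
    have := step j hj h
    refine (thr _ ?_).2 this
    rintro h'
    rw [h'] at this
    exact noI this
  generalize hj0 : nx jl = j0 at *
  obtain ⟨i0, b0⟩ := j0
  cases b0
  · have s1 : ∀ i, nx (flip (pv (flip ((i, false) : Ph k)))) = (i + 1, false) := by
      intro i; simp [flip, pv, nx]
    have all : ∀ i, O (i, false) := fun i => fin_cyc (fun i => O (i, false))
      (fun i h => by have := step' (i, false) rfl h; rwa [s1] at this) i0 i hO
    have := step (i0 - 1, false) rfl (all _)
    rw [s1] at this
    simp only [sub_add_cancel] at this
    exact noI this
  · have s1 : ∀ i, nx (flip (pv (flip ((i, true) : Ph k)))) = (i - 1, true) := by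
      intro i; simp [flip, pv, nx]
    have all : ∀ i, O (i, true) := by
      intro i
      by_contra hn
      refine fin_cyc (fun i => ¬ O (i, true)) (fun i h h' => h ?_) i i0 hn hO
      have := step' (i + 1, true) rfl h'
      rw [s1] at this
      simpa using this
    have := step (i0 + 1, true) rfl (all _)
    rw [s1] at this
    simp only [add_sub_cancel_right] at this
    exact noI this

end MG
end NSG

set_option linter.unusedSectionVars false

namespace NSG

/-- collapsing sequences -/
inductive Coll {k : ℕ} {E : Type} (E₀ : Set E) : Set E → Set (Ph k → E) → Prop
  | nil : Coll E₀ E₀ ∅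
  | step {S : Set E} {P : Set (Ph k → E)} (p : Ph k → E) (j : Ph k) : Coll E₀ S P → p j ∉ S →
      (∀ i, i ≠ j → p i ∈ S) → Coll E₀ (insert (p j) S) (insert p P)

namespace Coll

variable {k : ℕ} [NeZero k] {E : Type} {E₀ S : Set E} {P : Set (Ph k → E)}

theorem sub (h : Coll E₀ S P) : E₀ ⊆ S := by
  induction h with
  | nil => exact subset_rfl
  | step p j _ _ _ ih => exact ih.trans (Set.subset_insert _ _)

theorem range (h : Coll E₀ S P) : ∀ p ∈ P, ∀ j, p j ∈ S := by
  induction h with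
  | nil => simp
  | step p j _ _ h3 ih =>
    rintro q (rfl | hq) i
    · by_cases hi : i = j
      · subst hi; exact Set.mem_insert _ _
      · exact Set.mem_insert_of_mem _ (h3 i hi)
    · exact Set.mem_insert_of_mem _ (ih q hq i)

theorem exists_coll [Finite E] (m : ℕ) : ∀ (P : Set (Ph k → E)) (S : Set E), P.ncard = m →
    (∀ p ∈ P, ∀ j, p j ∈ S) →
    (∀ P' ⊆ P, P'.Nonempty → ∃ p ∈ P', ∃ j, ∀ q ∈ P', ∀ i, q i = p j → q = p ∧ i = j) →
    ∃ E₀, Coll E₀ S P := by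
  induction m with
  | zero =>
    intro P S hm _ _
    have : P = ∅ := (Set.ncard_eq_zero (Set.toFinite P)).1 hm
    subst this
    exact ⟨S, nil⟩
  | succ m ih =>
    intro P S hm hS hH
    have hne : P.Nonempty := by
      rw [← Set.ncard_pos (Set.toFinite P)]; omega
    obtain ⟨p, hp, j, hpj⟩ := hH P subset_rfl hne
    obtain ⟨E₀, hE⟩ := ih (P \ {p}) (S \ {p j}) (by
        rw [Set.ncard_sdiff_singleton_of_mem hp]; omega)
      (by
        rintro q ⟨hq, hqp⟩ i
        exact ⟨hS q hq i, fun h => hqp (hpj q hq i h).1⟩)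
      (fun P' hP' => hH P' (hP'.trans Set.sdiff_subset))
    refine ⟨E₀, ?_⟩
    have := step p j hE (by simp) (fun i hi => ⟨hS p hp i, fun h => hi (hpj p hp i h).2⟩)
    rwa [Set.insert_sdiff_singleton, Set.insert_sdiff_singleton, Set.insert_eq_of_mem hp,
      Set.insert_eq_of_mem (hS p hp j)] at this

theorem ext {Q : Type} [Group Q] (h : Coll E₀ S P) (α₀ : E → Q) :
    ∃ α : E → Q, (∀ e ∈ E₀, α e = α₀ e) ∧ ∀ p ∈ P, Triv (fun j => α (p j)) := by
  classical
  induction h with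
  | nil => exact ⟨α₀, by simp, by simp⟩
  | step p j h1 h2 h3 ih =>
    obtain ⟨α, a1, a2⟩ := ih
    obtain ⟨q, hq⟩ := triv_solve (fun i => α (p i)) j
    refine ⟨Function.update α (p j) q, ?_, ?_⟩
    · intro e he
      have : e ≠ p j := by rintro rfl; exact h2 (h1.sub he)
      rw [Function.update_of_ne this, a1 e he]
    · rintro r (rfl | hr)
      · refine hq _ ?_ (by simp)
        intro i hi
        have : r i ≠ r j := fun h => h2 (h ▸ h3 i hi)
        simp [this]
      · have : (fun i => Function.update α (p j) q (r i)) = fun i => α (r i) := by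
          funext i
          have : r i ≠ p j := fun h => h2 (h ▸ h1.range r hr i)
          simp [this]
        rw [this]
        exact a2 r hr

theorem uniq {Q : Type} [Group Q] (h : Coll E₀ S P) (α α' : E → Q)
    (h0 : ∀ e ∈ E₀, α e = α' e) (h1 : ∀ p ∈ P, Triv (fun j => α (p j)))
    (h2 : ∀ p ∈ P, Triv (fun j => α' (p j))) : ∀ e ∈ S, α e = α' e := by
  induction h with
  | nil => exact h0
  | step p j a1 a2 a3 ih =>
    have ih := ih (fun q hq => h1 q (Set.mem_insert_of_mem _ hq))
      (fun q hq => h2 q (Set.mem_insert_of_mem _ hq))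
    rintro e (rfl | he)
    · exact triv_det _ _ (h1 p (Set.mem_insert _ _)) (h2 p (Set.mem_insert _ _)) j
        (fun i hi => ih _ (a3 i hi))
    · exact ih e he

end Coll

namespace MG

variable {n k : ℕ} [NeZero k] {G : Type} [Group G] {x : Fin k → G} {φ : FreeGroup (Fin n) →* G}

theorem sol_hol {X : MG x φ} {Q : Type} [Group Q] {α : X.E → Q} {χ : FreeGroup (Fin n) →* Q}
    {β : X.V → Q} (h : ∀ e, α e = β (X.src e) * χ (X.val e) * (β (X.tgt e))⁻¹)
    {jl : Ph k} {p : Ph k → X.E} (hp : X.IsLine jl p) :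
    hol (fun j => α (p j)) (nx jl) (2 * k) = β (X.src (p (nx jl))) *
      χ (hol (fun j => X.val (p j)) (nx jl) (2 * k)) * (β (X.tgt (p jl)))⁻¹ := by
  simp only [h]
  rw [hol_gauge (fun j => χ (X.val (p j))) (fun j => β (X.src (p j))) (fun j => β (X.tgt (p j))) jl
    (fun j hj => by rw [hp.2 j hj]), hol_map]

theorem triv_val (hφ : Function.Surjective φ) (hrel : Triv (fun j : Ph k => x j.1))
    (hker : ∀ w, FreeGroup.lift x w = 1 → w ∈ Subgroup.normalClosure {nonorientableRelator k})
    (hR : ¬ Red φ) (X : MG x φ) (hX : X.Cls) : X.TrivCl X.val := by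
  obtain ⟨E₀, hE⟩ := Coll.exists_coll _ {p | X.IsPoly p} Set.univ rfl (by simp)
    (fun P' hP' hne => free_side hφ hker X hX P' hne hP')
  obtain ⟨α, h1, h2⟩ := hE.ext (FreeGroup.of (α := X.E))
  obtain ⟨χ, β, hα⟩ := hX.2.2.1 _ α h2
  let η : FreeGroup X.E →* G := FreeGroup.lift (fun e => x (X.lab e))
  have hη : ∀ e, η (α e) = x (X.lab e) := by
    intro e
    refine hE.uniq (fun e => η (α e)) (fun e => x (X.lab e)) ?_ ?_ ?_ e trivial
    · intro e he; simp [h1 e he, η]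
    · intro p hp j
      rw [← hol_map η (fun j => α (p j)), h2 p hp j, map_one]
    · intro p hp
      have : (fun j => x (X.lab (p j))) = fun j : Ph k => x j.1 := by
        funext j; rw [hp.1]
      rw [this]; exact hrel
  have hinj := key hR X hX.2.1 α η hη χ β hα
  intro p hp
  refine triv_of _ (nx (0, false)) ?_
  have := sol_hol hα (hp.isLine (0, false))
  rw [h2 p hp, hp.2, eq_comm, conj_eq_one_iff] at this
  exact hinj (this.trans (map_one χ).symm)

theorem hair_cls {X : MG x φ} (hX : X.Cls) (v : X.V) (i : Fin k) (b : Bool)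
    (hno : ∀ e, X.lab e = i → (bif b then X.src e else X.tgt e) ≠ v) : (X.hair v i b).Cls := by
  obtain ⟨hF, hG, hU, hN⟩ := hX
  refine ⟨?_, ?_, ?_, ?_⟩
  · rintro (_ | e) (_ | e') hl hst
    · rfl
    · exfalso
      have hl : i = X.lab e' := hl
      cases b
      · rcases hst with h | h
        · cases h
        · exact hno e' hl.symm (Option.some.inj h).symm
      · rcases hst with h | h
        · exact hno e' hl.symm (Option.some.inj h).symm
        · cases h
    · exfalso
      have hl : X.lab e = i := hl
      cases b
      · rcases hst with h | h
        · cases h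
        · exact hno e hl (Option.some.inj h)
      · rcases hst with h | h
        · exact hno e hl (Option.some.inj h)
        · cases h
    · rw [hF e e' hl]
      rcases hst with h | h
      · exact Or.inl (Option.some.inj h)
      · exact Or.inr (Option.some.inj h)
  · have := hair_genS X v i b (S := ⊤) ⟨hG.1, fun q _ u v => hG.2 u v q⟩
    exact ⟨this.1, fun u v q => this.2 q trivial u v⟩
  · intro Q _ α hα
    refine hair_sol X v i b α (hU Q _ fun p hp => ?_)
    exact hα (fun j => some (p j)) ⟨hp.1, fun j => congrArg some (hp.2 j)⟩
  · rintro ⟨w, hw⟩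
    apply hN
    cases w with
    | none =>
      exfalso
      obtain ⟨e, h1, h2, _⟩ := hw 0
      cases e with
      | none =>
        cases b
        · cases h2
        · cases h1
      | some e => cases h1
    | some w =>
      refine ⟨w, fun i' => ?_⟩
      obtain ⟨e, h1, h2, h3⟩ := hw i'
      cases e with
      | none =>
        exfalso
        cases b
        · cases h1
        · cases h2
      | some e => exact ⟨e, Option.some.inj h1, Option.some.inj h2, h3⟩

theorem cls_h1 (X : MG x φ) (hX : X.Cls) (v : X.V) (i : Fin k) (b : Bool) :
    ∃ (Y : MG x φ) (f : X.V → Y.V), Y.Cls ∧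
      Hom X Y f ∧ ∃ e, Y.lab e = i ∧ (bif b then Y.src e else Y.tgt e) = f v := by
  by_cases h : ∃ e, X.lab e = i ∧ (bif b then X.src e else X.tgt e) = v
  · exact ⟨X, id, hX, Hom.id X, h⟩
  · push Not at h
    refine ⟨X.hair v i b, some, hair_cls hX v i b h, hair_hom X v i b, none, rfl, ?_⟩
    cases b <;> rfl

theorem add_poly (hrel : Triv (fun j : Ph k => x j.1)) (Y : MG x φ) (hY : Y.Cls) (hNB : Y.NonBad)
    (s t : Ph k → Y.V) (hst : ∀ j, t j = s (nx j)) (j₀ : Ph k)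
    (he : ∀ i, i ≠ j₀ → ∃ e, Y.src e = s i ∧ Y.tgt e = t i ∧ Y.lab e = i.1) :
    ∃ (Z : MG x φ) (f : Y.V → Z.V), Z.Cls ∧ Hom Y Z f ∧ Nat.card Z.V ≤ Nat.card Y.V ∧
      ∃ e, Z.src e = f (s j₀) ∧ Z.tgt e = f (t j₀) ∧ Z.lab e = j₀.1 := by
  classical
  obtain ⟨e0, -⟩ := he _ (flip_ne j₀)
  have he' : ∀ i, ∃ e, i ≠ j₀ → Y.src e = s i ∧ Y.tgt e = t i ∧ Y.lab e = i.1 := by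
    intro i
    by_cases hi : i = j₀
    · exact ⟨e0, fun h => absurd hi h⟩
    · obtain ⟨e, h⟩ := he i hi; exact ⟨e, fun _ => h⟩
  choose e he' using he'
  have nxne : ∀ j : Ph k, nx j ≠ j := by
    intro j
    have := nx_ne j 1 (by omega) (by have := NeZero.pos k; omega)
    simpa using this
  by_cases hout : ∃ e1, Y.lab e1 = j₀.1 ∧ Y.src e1 = s j₀
  · obtain ⟨e1, hl, hs⟩ := hout
    have hp : Y.IsLine j₀ (Function.update e j₀ e1) := by
      constructor
      · intro j
        by_cases hj : j = j₀
        · subst hj; simpa using hl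
        · simp [hj, (he' j hj).2.2]
      · intro j hj
        rw [Function.update_of_ne hj, (he' j hj).2.1, hst]
        by_cases hj' : nx j = j₀
        · rw [hj', Function.update_self, hs]
        · rw [Function.update_of_ne hj', (he' _ hj').1]
    have h := (hNB _ _ hp).2 j₀
    rw [Function.update_self, Function.update_of_ne (nxne _), (he' _ (nxne _)).1, ← hst] at h
    exact ⟨Y, id, hY, Hom.id Y, le_rfl, e1, hs, h, hl⟩
  by_cases hin : ∃ e1, Y.lab e1 = j₀.1 ∧ Y.tgt e1 = t j₀
  · obtain ⟨e1, hl, ht⟩ := hin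
    have hp : Y.IsLine (pv j₀) (Function.update e j₀ e1) := by
      constructor
      · intro j
        by_cases hj : j = j₀
        · subst hj; simpa using hl
        · simp [hj, (he' j hj).2.2]
      · intro j hj
        have hj' : nx j ≠ j₀ := by rintro rfl; exact hj (pv_nx j).symm
        rw [Function.update_of_ne hj', (he' _ hj').1, ← hst]
        by_cases hj2 : j = j₀
        · subst hj2; rw [Function.update_self, ht]
        · rw [Function.update_of_ne hj2, (he' _ hj2).2.1]
    have h := (hNB _ _ hp).2 (pv j₀)
    have hpv : pv j₀ ≠ j₀ := by
      intro h; have := nxne (pv j₀); rw [nx_pv] at this; exact this h.symm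
    rw [nx_pv, Function.update_self, Function.update_of_ne hpv, (he' _ hpv).2.1, hst, nx_pv] at h
    exact ⟨Y, id, hY, Hom.id Y, le_rfl, e1, h.symm, ht, hl⟩
  push Not at hout hin
  obtain ⟨hF, hG, hU, hN⟩ := hY
  obtain ⟨q, hq⟩ := triv_solve (fun i => Y.val (e i)) j₀
  let g : Ph k → FreeGroup (Fin n) := fun i => if i = j₀ then q else Y.val (e i)
  have hg : Triv g := hq g (fun i hi => by simp [g, hi]) (by simp [g])
  have gen : ∀ {Q : Type} [Group Q] (a b : Ph k → Q), Triv a → (∀ j, b j = b j) →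
      ∀ c : Y.V → Q, Triv (fun j => c (s j) * a j * (c (t j))⁻¹) := by
    intro Q _ a b ha _ c
    refine triv_of _ (nx j₀) ?_
    rw [hol_gauge a (fun j => c (s j)) (fun j => c (t j)) j₀ (fun j _ => by rw [hst]), ha, hst]
    simp
  have hcomp : φ q = Y.pot (s j₀) * x j₀.1 * (Y.pot (t j₀))⁻¹ := by
    have h1 : Triv (fun j => φ (g j)) := fun j => by rw [← hol_map, hg, map_one]
    have h2 := gen _ (fun _ => 1) hrel (fun _ => rfl) Y.pot
    have := triv_det _ _ h1 h2 j₀ (fun i hi => by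
      simp only [g, hi, if_false]
      rw [Y.compat, (he' i hi).1, (he' i hi).2.1, (he' i hi).2.2])
    simpa [g] using this
  let Z := Y.addEdge (s j₀) (t j₀) j₀.1 q hcomp
  have hZF : Z.Folded := by
    rintro (_ | e) (_ | e') hl h
    · rfl
    · exfalso
      rcases h with h | h
      · exact hout e' hl.symm h.symm
      · exact hin e' hl.symm h.symm
    · exfalso
      rcases h with h | h
      · exact hout e hl h
      · exact hin e hl h
    · rw [hF e e' hl h]
  have hZG : Z.Gen := ⟨hG.1, fun u v p => Y.addEdge_conn _ _ _ _ _ (hG.2 u v p)⟩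
  refine ⟨Z, id, ⟨hZF, hZG, ?_, ?_⟩, fun c => ⟨some c, rfl, rfl, rfl⟩, le_rfl, none, rfl, rfl, rfl⟩
  · intro Q _ α hα
    obtain ⟨χ, β, h⟩ := hU Q (fun c => α (some c)) (fun p hp =>
      hα (fun j => some (p j)) ⟨hp.1, hp.2⟩)
    refine ⟨χ, β, ?_⟩
    rintro (_ | c)
    · let p : Ph k → Z.E := fun i => if i = j₀ then none else some (e i)
      have hs : ∀ i, Z.src (p i) = s i := by
        intro i
        by_cases hi : i = j₀
        · subst hi; simp only [p, if_true]; rfl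
        · simp only [p, hi, if_false]; exact (he' i hi).1
      have ht : ∀ i, Z.tgt (p i) = t i := by
        intro i
        by_cases hi : i = j₀
        · subst hi; simp only [p, if_true]; rfl
        · simp only [p, hi, if_false]; exact (he' i hi).2.1
      have hp : Z.IsPoly p := by
        refine ⟨fun i => ?_, fun i => by rw [hs, ht, hst]⟩
        by_cases hi : i = j₀
        · subst hi; simp only [p, if_true]; rfl
        · simp only [p, hi, if_false]; exact (he' i hi).2.2
      have h1 := hα p hp
      have h2 := gen (fun j => χ (g j)) (fun _ => 1)
        (fun j => by rw [← hol_map, hg, map_one]) (fun _ => rfl) β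
      have := triv_det _ _ h1 h2 j₀ (fun i hi => by
        have hpi : p i = some (e i) := if_neg hi
        have hgi : g i = Y.val (e i) := if_neg hi
        show α (p i) = _
        rw [hpi, hgi]
        refine (h (e i)).trans ?_
        rw [(he' i hi).1, (he' i hi).2.1])
      simp only [p, g, if_true] at this
      exact this
    · exact h c
  · rintro ⟨v, hv⟩
    have single : ∀ w, w = v := by
      intro w
      refine (hZG.2 v w 1).closed (fun w => w = v) ?_ ?_ rfl
      · intro c hc
        obtain ⟨d, h1, h2, h3⟩ := hv (Z.lab c)
        have : d = c := hZF _ _ h3 (Or.inl (h1.trans hc.symm))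
        rw [← this, h2]
      · intro c hc
        obtain ⟨d, h1, h2, h3⟩ := hv (Z.lab c)
        have : d = c := hZF _ _ h3 (Or.inr (h2.trans hc.symm))
        rw [← this, h1]
    refine hout (e (flip j₀)) ?_ ?_
    · rw [(he' _ (flip_ne j₀)).2.2]; rfl
    · rw [single (s j₀)]; exact single _

end MG
end NSG

set_option linter.unusedSectionVars false

namespace NSG
namespace MG

variable {n k : ℕ} [NeZero k] {G : Type} [Group G] {x : Fin k → G} {φ : FreeGroup (Fin n) →* G}

theorem gauge_cls {X : MG x φ} (hX : X.Cls) (h : X.V → FreeGroup (Fin n)) : (X.gauge h).Cls := by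
  obtain ⟨hF, hG, hU, hN⟩ := hX
  refine ⟨hF, gauge_gen h hG, ?_, hN⟩
  intro Q _ α hα
  exact gauge_sol h (hU Q α hα)

theorem collapse1 (hφ : Function.Surjective φ) (hrel : Triv (fun j : Ph k => x j.1))
    (hker : ∀ w, FreeGroup.lift x w = 1 → w ∈ Subgroup.normalClosure {nonorientableRelator k})
    (hR : ¬ Red φ) (X : MG x φ) (hX : X.Cls) (jl : Ph k) (r : Ph k → X.E) (hr : X.IsLine jl r)
    (hr' : X.tgt (r jl) ≠ X.src (r (nx jl)))
    (hv : hol (fun j => X.val (r j)) (nx jl) (2 * k) = 1) :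
    ∃ (Y : MG x φ) (f : X.V → Y.V) (E₀ : Set X.E), Y.Gen ∧ Y.U0 ∧ Nat.card Y.V < Nat.card X.V ∧
      Coll E₀ Set.univ {p | X.IsPoly p ∨ p = r} ∧
      (∀ e ∈ E₀, ∃ e', Y.src e' = f (X.src e) ∧ Y.tgt e' = f (X.tgt e) ∧ Y.lab e' = X.lab e) ∧
      f (X.tgt (r jl)) = f (X.src (r (nx jl))) := by
  obtain ⟨E₀, hE⟩ := Coll.exists_coll _ {p | X.IsPoly p ∨ p = r} Set.univ rfl (by simp)
    (fun P' hP' hne => free_side' hφ hker X hX jl r hr hr' P' hne hP')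
  have htv := triv_val hφ hrel hker hR X hX
  have htv' : ∀ p ∈ {p | X.IsPoly p ∨ p = r}, Triv (fun j => X.val (p j)) := by
    rintro p (hp | rfl)
    · exact htv p hp
    · exact triv_of _ _ hv
  have hpot : X.pot (X.src (r (nx jl))) = X.pot (X.tgt (r jl)) := by
    have h1 : hol (fun j => φ (X.val (r j))) (nx jl) (2 * k) = 1 := by
      rw [← hol_map, hv, map_one]
    simp only [X.compat] at h1
    rw [hol_gauge (fun j => x (X.lab (r j))) (fun j => X.pot (X.src (r j)))
      (fun j => X.pot (X.tgt (r j))) jl (fun j hj => by rw [hr.2 j hj])] at h1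
    simp only [hr.1] at h1
    rw [hrel, mul_one, mul_inv_eq_one] at h1
    exact h1
  generalize hu : X.src (r (nx jl)) = u at *
  generalize hu' : X.tgt (r jl) = u' at *
  have hne : u ≠ u' := fun h => hr' h.symm
  let f := idf u u' hne
  have hst : ∀ p ∈ {p | X.IsPoly p ∨ p = r}, ∀ j, f (X.tgt (p j)) = f (X.src (p (nx j))) := by
    rintro p (hp | rfl) j
    · rw [hp.2]
    · by_cases hj : j = jl
      · subst hj; rw [hu, hu']; exact (idf_w u u' hne).symm
      · rw [hr.2 j hj]
  refine ⟨X.push {v // v ≠ u'} E₀ f Subtype.val (fun v => X.pot v)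
    (fun v => idf_apply u u' hne X.pot hpot v), f, E₀, ?_, ?_, ?_, hE, ?_, (idf_w u u' hne).symm⟩
  · refine push_gen _ _ _ _ _ _ hX.2.1 (idf_surj u u' hne) ?_
    have key : ∀ {S : Set X.E} {P : Set (Ph k → X.E)}, Coll E₀ S P →
        (∀ p ∈ P, Triv (fun j => X.val (p j))) →
        (∀ p ∈ P, ∀ j, f (X.tgt (p j)) = f (X.src (p (nx j)))) →
        ∀ e ∈ S, Conn (fun e : E₀ => f (X.src e)) (fun e : E₀ => f (X.tgt e))
          (fun e : E₀ => X.val e) (f (X.src e)) (f (X.tgt e)) (X.val e) := by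
      intro S P hC
      induction hC with
      | nil => intro _ _ e he; exact Conn.edge (src := fun e : E₀ => f (X.src e))
                (tgt := fun e : E₀ => f (X.tgt e)) (a := fun e : E₀ => X.val e) ⟨e, he⟩
      | step p j a1 a2 a3 ih =>
        intro h1 h2
        have ih := ih (fun q hq => h1 q (Set.mem_insert_of_mem _ hq))
          (fun q hq => h2 q (Set.mem_insert_of_mem _ hq))
        rintro e (rfl | he)
        · have c := hol_conn (fun j => f (X.src (p j))) (fun j => f (X.tgt (p j)))
            (fun j => X.val (p j)) j (fun i hi => ih _ (a3 i hi)) (h2 p (Set.mem_insert _ _))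
          have t := h1 p (Set.mem_insert _ _) j
          rw [hol_split] at t
          exact c.symm.cast rfl rfl (eq_inv_of_mul_eq_one_left t).symm
        · exact ih e he
    exact fun e => key hE htv' hst e trivial
  · intro Q _ α₀
    classical
    obtain ⟨α, h1, h2⟩ := hE.ext (fun e => if h : e ∈ E₀ then α₀ ⟨e, h⟩ else 1)
    obtain ⟨χ, β, hα⟩ := hX.2.2.1 Q α (fun p hp => h2 p (Or.inl hp))
    have hβ : β u = β u' := by
      have := sol_hol hα hr
      rw [hv, h2 r (Or.inr rfl), map_one, mul_one, hu, hu', eq_comm, mul_inv_eq_one] at this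
      exact this
    refine ⟨χ, fun v : {v // v ≠ u'} => β v, ?_⟩
    intro (e : E₀)
    have e1 := hα e
    rw [h1 e e.2, dif_pos e.2] at e1
    have b1 := idf_apply u u' hne β hβ (X.src e)
    have b2 := idf_apply u u' hne β hβ (X.tgt e)
    show α₀ e = β (f (X.src e)) * χ (X.val e) * (β (f (X.tgt e)))⁻¹
    rw [b1, b2]
    exact e1
  · have := card_ne u'
    show Nat.card {v // v ≠ u'} < _
    omega
  · intro e he
    exact ⟨⟨e, he⟩, rfl, rfl, rfl⟩

theorem collapse (hφ : Function.Surjective φ) (hrel : Triv (fun j : Ph k => x j.1))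
    (hker : ∀ w, FreeGroup.lift x w = 1 → w ∈ Subgroup.normalClosure {nonorientableRelator k})
    (hR : ¬ Red φ) (X : MG x φ) (hX : X.Cls) (jl : Ph k) (r : Ph k → X.E) (hr : X.IsLine jl r)
    (hr' : X.tgt (r jl) ≠ X.src (r (nx jl))) :
    ∃ (Y : MG x φ) (f : X.V → Y.V) (E₀ : Set X.E), Y.Gen ∧ Y.U0 ∧ Nat.card Y.V < Nat.card X.V ∧
      Coll E₀ Set.univ {p | X.IsPoly p ∨ p = r} ∧
      (∀ e ∈ E₀, ∃ e', Y.src e' = f (X.src e) ∧ Y.tgt e' = f (X.tgt e) ∧ Y.lab e' = X.lab e) ∧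
      f (X.tgt (r jl)) = f (X.src (r (nx jl))) := by
  classical
  let h : X.V → FreeGroup (Fin n) := fun v => if v = X.tgt (r jl) then
    hol (fun j => X.val (r j)) (nx jl) (2 * k) else 1
  refine collapse1 hφ hrel hker hR (X.gauge h) (gauge_cls hX h) jl r hr hr' ?_
  have := hol_gauge (fun j => X.val (r j)) (fun j => h (X.src (r j)))
      (fun j => h (X.tgt (r j))) jl (fun j hj => by rw [hr.2 j hj])
  refine this.trans ?_
  simp [h, hr'.symm]

theorem claim (hφ : Function.Surjective φ) (hrel : Triv (fun j : Ph k => x j.1))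
    (hker : ∀ w, FreeGroup.lift x w = 1 → w ∈ Subgroup.normalClosure {nonorientableRelator k})
    (hR : ¬ Red φ) (hNR : ∀ Y : MG x φ, Y.Folded → Y.Gen → Y.U0 → ¬ Y.IsRose) (m : ℕ) :
    ∀ X : MG x φ, X.Cls → Nat.card X.V = m → ∃ (Y : MG x φ) (f : X.V → Y.V), Hom X Y f ∧ Y.Cls ∧
      Y.NonBad ∧ Nat.card Y.V ≤ Nat.card X.V := by
  induction m using Nat.strong_induction_on with
  | _ m IH =>
  intro X hX hm
  by_cases hNB : X.NonBad
  · exact ⟨X, id, Hom.id X, hX, hNB, le_rfl⟩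
  unfold NonBad at hNB
  push Not at hNB
  obtain ⟨jl, r, hr, hr2⟩ := hNB
  have hr' : X.tgt (r jl) ≠ X.src (r (nx jl)) := by
    intro h
    refine hr2 ⟨hr.1, fun j => ?_⟩
    by_cases hj : j = jl
    · subst hj; exact h
    · exact hr.2 j hj
  obtain ⟨W, f, E₀, hWG, hWU, hWc, hE, hEe, hff⟩ := collapse hφ hrel hker hR X hX jl r hr hr'
  obtain ⟨X0, f0, hf0, h0F, h0G, h0U, h0c⟩ := foldStar hR W hWG hWU
  have h0 : X0.Cls := ⟨h0F, h0G, fun Q _ α _ => h0U Q α, hNR X0 h0F h0G h0U⟩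
  have key : ∀ {S : Set X.E} {P : Set (Ph k → X.E)}, Coll E₀ S P →
      (∀ p ∈ P, X.IsPoly p ∨ p = r) →
      ∃ (Y : MG x φ) (g : X.V → Y.V), Y.Cls ∧ Y.NonBad ∧ Nat.card Y.V < m ∧
        g (X.tgt (r jl)) = g (X.src (r (nx jl))) ∧
        ∀ e ∈ S, ∃ e', Y.src e' = g (X.src e) ∧ Y.tgt e' = g (X.tgt e) ∧ Y.lab e' = X.lab e := by
    intro S P hC
    induction hC with
    | nil =>
      intro _
      obtain ⟨Y, g, hg, hY, hYN, hYc⟩ := IH _ (by omega) X0 h0 rfl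
      refine ⟨Y, g ∘ f0 ∘ f, hY, hYN, by omega, by simp [hff], fun e he => ?_⟩
      obtain ⟨e1, a1, a2, a3⟩ := hEe e he
      obtain ⟨e2, b1, b2, b3⟩ := (hg.comp hf0) e1
      exact ⟨e2, by simp [b1, a1], by simp [b2, a2], b3.trans a3⟩
    | step p j a1 a2 a3 ih =>
      intro hP
      obtain ⟨Y, g, hY, hYN, hYc, hgg, hge⟩ := ih (fun q hq => hP q (Set.mem_insert_of_mem _ hq))
      have hp := hP p (Set.mem_insert _ _)
      have hlab : ∀ i, X.lab (p i) = i.1 := by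
        rcases hp with hp | rfl
        · exact hp.1
        · exact hr.1
      have hst : ∀ i, g (X.tgt (p i)) = g (X.src (p (nx i))) := by
        rcases hp with hp | rfl
        · intro i; rw [hp.2]
        · intro i
          by_cases hi : i = jl
          · subst hi; exact hgg
          · rw [hr.2 i hi]
      obtain ⟨Z, f1, hZ, hf1, hZc, e1, c1, c2, c3⟩ := add_poly hrel Y hY hYN
        (fun i => g (X.src (p i))) (fun i => g (X.tgt (p i))) hst j (fun i hi => by
          obtain ⟨e', d1, d2, d3⟩ := hge _ (a3 i hi)
          exact ⟨e', d1, d2, d3.trans (hlab i)⟩)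
      obtain ⟨U, f2, hf2, hU, hUN, hUc⟩ := IH _ (by omega) Z hZ rfl
      refine ⟨U, f2 ∘ f1 ∘ g, hU, hUN, by omega, by simp [hgg], ?_⟩
      rintro e (rfl | he)
      · obtain ⟨e2, b1, b2, b3⟩ := hf2 e1
        exact ⟨e2, by simp [b1, c1], by simp [b2, c2], by rw [b3, c3, hlab]⟩
      · obtain ⟨e1, d1, d2, d3⟩ := hge e he
        obtain ⟨e2, b1, b2, b3⟩ := (hf2.comp hf1) e1
        exact ⟨e2, by simp [b1, d1], by simp [b2, d2], b3.trans d3⟩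
  obtain ⟨Y, g, hY, hYN, hYc, -, hge⟩ := key hE (fun p hp => hp)
  exact ⟨Y, g, fun e => hge e trivial, hY, hYN, by omega⟩

end MG
end NSG

set_option linter.unusedSectionVars false

namespace NSG
namespace MG

variable {n k : ℕ} [NeZero k] {G : Type} [Group G] {x : Fin k → G} {φ : FreeGroup (Fin n) →* G}

theorem IsPoly.reads {Y : MG x φ} {p : Ph k → Y.E} (hl : Y.IsPoly p) :
    Y.Reads (Y.src (p (0, false))) (Y.src (p (0, false))) (nonorientableRelator k) := by
  have hc := hol_conn (src := Y.src) (tgt := Y.tgt) (a := fun e => FreeGroup.of (Y.lab e))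
    (fun j => Y.src (p j)) (fun j => Y.tgt (p j)) (fun j => FreeGroup.of (Y.lab (p j)))
    (0, false) (fun i _ => Conn.edge (p i)) hl.2
  have hc2 := (Conn.edge (src := Y.src) (tgt := Y.tgt) (a := fun e => FreeGroup.of (Y.lab e))
    (p (0, false))).trans hc
  refine hc2.cast rfl rfl ?_
  have := hol_split (fun j => FreeGroup.of (Y.lab (p j))) (0, false)
  rw [← this]
  simp only [hl.1]
  rw [hol_relator]
  exact FreeGroup.lift_of_apply _

theorem read_line (X : MG x φ) (hX : X.Cls) (v : X.V) (j₀ : Ph k) (m : ℕ) :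
    ∃ (Y : MG x φ) (f : X.V → Y.V) (s : ℕ → Y.V), Y.Cls ∧ Hom X Y f ∧ s 0 = f v ∧
      ∀ t < m, ∃ e, Y.src e = s t ∧ Y.tgt e = s (t + 1) ∧ Y.lab e = (nx^[t] j₀).1 := by
  classical
  induction m with
  | zero => exact ⟨X, id, fun _ => v, hX, Hom.id X, rfl, by simp⟩
  | succ m ih =>
    obtain ⟨Y, f, s, hY, hf, h0, hs⟩ := ih
    obtain ⟨Z, g, hZ, hg, e, he1, he2⟩ := cls_h1 Y hY (s m) (nx^[m] j₀).1 true
    have he2 : Z.src e = g (s m) := he2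
    refine ⟨Z, g ∘ f, fun t => if t ≤ m then g (s t) else Z.tgt e, hZ, hg.comp hf, by simp [h0], ?_⟩
    intro t ht
    by_cases htm : t = m
    · subst htm
      exact ⟨e, by simp [he2], by simp, he1⟩
    · obtain ⟨e1, a1, a2, a3⟩ := hs t (by omega)
      obtain ⟨e2, b1, b2, b3⟩ := hg e1
      have c1 : t ≤ m := by omega
      have c2 : t + 1 ≤ m := by omega
      exact ⟨e2, by simp [c1, b1, a1], by simp [c2, b2, a2], b3.trans a3⟩

theorem phase_index (j₀ j : Ph k) : ∃ t < 2 * k, nx^[t] j₀ = j := by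
  have hk := NeZero.pos k
  refine ph_cyc (fun j => ∃ t < 2 * k, nx^[t] j₀ = j) ?_ j₀ j ⟨0, by omega, rfl⟩
  rintro j ⟨t, ht, rfl⟩
  by_cases h : t + 1 = 2 * k
  · exact ⟨0, by omega, by
      have h2 := nx_period j₀
      rw [← h, Function.iterate_succ_apply'] at h2
      exact h2.symm⟩
  · exact ⟨t + 1, by omega, Function.iterate_succ_apply' nx t j₀⟩

theorem phase_index_unique (j₀ : Ph k) {t t' : ℕ} (ht : t < 2 * k) (ht' : t' < 2 * k)
    (h : nx^[t] j₀ = nx^[t'] j₀) : t = t' := by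
  have aux : ∀ t t' : ℕ, t < t' → t' < 2 * k → nx^[t] j₀ = nx^[t'] j₀ → False := by
    intro t t' h1 h2 h
    apply nx_ne (nx^[t] j₀) (t' - t) (by omega) (by omega)
    rw [← Function.iterate_add_apply, h]
    congr 2; omega
  rcases lt_trichotomy t t' with h1 | h1 | h1
  · exact (aux _ _ h1 ht' h).elim
  · exact h1
  · exact (aux _ _ h1 ht h.symm).elim

theorem red_or_rose (hφ : Function.Surjective φ) (hrel : Triv (fun j : Ph k => x j.1))
    (hker : ∀ w, FreeGroup.lift x w = 1 → w ∈ Subgroup.normalClosure {nonorientableRelator k})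
    (hx : Subgroup.closure (Set.range x) = ⊤) :
    Red φ ∨ ∃ Y : MG x φ, Y.Folded ∧ Y.Gen ∧ Y.U0 ∧ Y.IsRose := by
  by_contra hcon
  push Not at hcon
  obtain ⟨hR, hNR⟩ := hcon
  have hcl := claim hφ hrel hker hR hNR
  have : Nonempty (Fin k) := ⟨0⟩
  obtain ⟨X0, hG0, hU0, -⟩ := initial φ hx
  obtain ⟨X, _, -, hF, hG, hU, -⟩ := foldStar hR X0 hG0 hU0
  have hX : X.Cls := ⟨hF, hG, fun Q _ α _ => hU Q α, hNR X hF hG hU⟩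
  obtain ⟨Y, hY, hYR⟩ := rose Cls (fun X hX => ⟨hX.1, hX.2.1⟩) cls_h1 (by
    intro X hX v
    let j₀ : Ph k := (0, false)
    obtain ⟨Y, f, s, hY, hf, h0, hs⟩ := read_line X hX v j₀ (2 * k)
    choose idx hidx1 hidx2 using phase_index j₀
    choose e he1 he2 he3 using fun j => hs (idx j) (hidx1 j)
    have hline : Y.IsLine (pv j₀) e := by
      refine ⟨fun j => by rw [he3, hidx2], fun j hj => ?_⟩
      rw [he1, he2]
      congr 1
      have hlt : idx j + 1 < 2 * k := by
        by_contra hlt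
        have h1 : idx j + 1 = 2 * k := by have := hidx1 j; omega
        apply hj
        have h2 := nx_period j₀
        rw [← h1, Function.iterate_succ_apply', hidx2] at h2
        rw [← h2, pv_nx]
      apply phase_index_unique j₀ hlt (hidx1 _)
      rw [hidx2, Function.iterate_succ_apply', hidx2]
    have hi0 : idx j₀ = 0 := by
      apply phase_index_unique j₀ (hidx1 _) (by have := hidx1 j₀; omega)
      rw [hidx2]; rfl
    obtain ⟨Z, g, hg, hZ, hZN, -⟩ := hcl _ Y hY rfl
    have hsrc : Y.src (e j₀) = f v := by rw [he1, hi0, h0]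
    choose c hc1 hc2 hc3 using fun j => hg (e j)
    have hpoly := hZN (pv j₀) c ⟨fun j => by rw [hc3, hline.1], fun j hj => by
      rw [hc1, hc2, hline.2 j hj]⟩
    refine ⟨Z, g ∘ f, hZ, hg.comp hf, ?_⟩
    have := hpoly.reads
    rw [hc1] at this
    exact Conn.cast this (by simp [← hsrc, j₀]) (by simp [← hsrc, j₀]) rfl) hφ hker X hX
  exact hY.2.2.2 hYR

/-- the standard form -/
theorem std_of_rose (Y : MG x φ) (hF : Y.Folded) (hG : Y.Gen) (hU : Y.U0) (hR : Y.IsRose) :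
    ∃ (ψ : FreeGroup (Fin k) ≃* FreeGroup (Fin n)) (g : G),
      ∀ i, φ (ψ (FreeGroup.of i)) = g * x i * g⁻¹ := by
  obtain ⟨v, hv⟩ := hR
  choose c c1 c2 c3 using hv
  have single : ∀ w, w = v := by
    intro w
    refine (hG.2 v w 1).closed (fun w => w = v) ?_ ?_ rfl
    · intro e he
      have : c (Y.lab e) = e := hF _ _ (c3 _) (Or.inl ((c1 _).trans he.symm))
      rw [← this, c2]
    · intro e he
      have : c (Y.lab e) = e := hF _ _ (c3 _) (Or.inr ((c2 _).trans he.symm))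
      rw [← this, c1]
  have hc : ∀ e, c (Y.lab e) = e := fun e =>
    hF _ _ (c3 _) (Or.inl ((c1 _).trans (single _).symm))
  let ψ : FreeGroup (Fin k) →* FreeGroup (Fin n) := FreeGroup.lift (fun i => Y.val (c i))
  have hsurj : Function.Surjective ψ := by
    intro q
    have h := (hG.2 v v q).mem_closure
    have : Subgroup.closure (Set.range Y.val) ≤ ψ.range := by
      rw [Subgroup.closure_le]
      rintro _ ⟨e, rfl⟩
      exact ⟨FreeGroup.of (Y.lab e), by simp [ψ, hc]⟩
    exact this h
  have hinj : Function.Injective ψ := by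
    obtain ⟨χ, β, hα⟩ := hU _ (fun e => FreeGroup.of (Y.lab e))
    have h2 : ∀ w, w = β v * χ (ψ w) * (β v)⁻¹ := by
      intro w
      have : MonoidHom.id (FreeGroup (Fin k)) = (MulAut.conj (β v)).toMonoidHom.comp (χ.comp ψ) := by
        ext i
        have := hα (c i)
        beta_reduce at this
        rw [c1, c2, c3] at this
        simpa [ψ] using this
      simpa using DFunLike.congr_fun this w
    intro a b hab
    rw [h2 a, h2 b, hab]
  refine ⟨MulEquiv.ofBijective ψ ⟨hinj, hsurj⟩, Y.pot v, fun i => ?_⟩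
  have := Y.compat (c i)
  rw [c1, c2, c3] at this
  have h2 : ψ (FreeGroup.of i) = Y.val (c i) := by simp [ψ]
  show φ (ψ (FreeGroup.of i)) = _
  rw [h2]; exact this

end MG
end NSG

set_option linter.unusedSectionVars false

namespace NSG

theorem red_last {m : ℕ} {G : Type} [Group G] (φ : FreeGroup (Fin (m + 1)) →* G) (hR : Red φ) :
    ∃ θ : FreeGroup (Fin (m + 1)) ≃* FreeGroup (Fin (m + 1)),
      φ (θ (FreeGroup.of (Fin.last m))) = 1 := by
  obtain ⟨y, hy, j, hj⟩ := hR
  let θ : FreeGroup (Fin (m + 1)) →* FreeGroup (Fin (m + 1)) :=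
    FreeGroup.lift (fun i => y (Equiv.swap j (Fin.last m) i))
  have hs : Function.Surjective θ := by
    rw [← MonoidHom.range_eq_top, ← top_le_iff, ← hy, Subgroup.closure_le]
    rintro _ ⟨i, rfl⟩
    exact ⟨FreeGroup.of (Equiv.swap j (Fin.last m) i), by simp [θ]⟩
  refine ⟨MulEquiv.ofBijective θ ⟨hopf θ hs, hs⟩, ?_⟩
  show φ (θ (FreeGroup.of (Fin.last m))) = 1
  simp [θ, hj]

/-- extension of an endomorphism by a fixed last generator -/
def extLast {m : ℕ} (a : FreeGroup (Fin m) →* FreeGroup (Fin m)) :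
    FreeGroup (Fin (m + 1)) →* FreeGroup (Fin (m + 1)) :=
  FreeGroup.lift (Fin.lastCases (FreeGroup.of (Fin.last m))
    (fun i => FreeGroup.map Fin.castSucc (a (FreeGroup.of i))))

theorem extLast_last {m : ℕ} (a : FreeGroup (Fin m) →* FreeGroup (Fin m)) :
    extLast a (FreeGroup.of (Fin.last m)) = FreeGroup.of (Fin.last m) := by
  simp [extLast]

theorem extLast_map {m : ℕ} (a : FreeGroup (Fin m) →* FreeGroup (Fin m)) (w : FreeGroup (Fin m)) :
    extLast a (FreeGroup.map Fin.castSucc w) = FreeGroup.map Fin.castSucc (a w) := by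
  have : (extLast a).comp (FreeGroup.map Fin.castSucc) = (FreeGroup.map Fin.castSucc).comp a := by
    ext i
    simp [extLast]
  exact DFunLike.congr_fun this w

theorem extLast_comp {m : ℕ} (a b : FreeGroup (Fin m) →* FreeGroup (Fin m))
    (h : a.comp b = MonoidHom.id _) : (extLast a).comp (extLast b) = MonoidHom.id _ := by
  ext i
  refine Fin.lastCases ?_ (fun i => ?_) i
  · simp [extLast_last]
  · have := extLast_map b (FreeGroup.of i)
    rw [FreeGroup.map.of] at this
    rw [MonoidHom.comp_apply, this, extLast_map]
    have := DFunLike.congr_fun h (FreeGroup.of i)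
    rw [MonoidHom.comp_apply] at this
    rw [this]; simp

theorem restrict_surj {m : ℕ} {G : Type} [Group G] (φ : FreeGroup (Fin (m + 1)) →* G)
    (hφ : Function.Surjective φ) (h : φ (FreeGroup.of (Fin.last m)) = 1) :
    Function.Surjective (φ.comp (FreeGroup.map Fin.castSucc)) := by
  rw [← MonoidHom.range_eq_top, ← top_le_iff, ← MonoidHom.range_eq_top.2 hφ,
    MonoidHom.range_eq_map, ← FreeGroup.closure_range_of, MonoidHom.map_closure, Subgroup.closure_le]
  rintro _ ⟨_, ⟨i, rfl⟩, rfl⟩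
  refine Fin.lastCases ?_ (fun i => ?_) i
  · rw [h]; exact one_mem _
  · exact ⟨FreeGroup.of i, by simp⟩

theorem transitive {k : ℕ} [NeZero k] {G : Type} [Group G] (x : Fin k → G)
    (hrel : Triv (fun j : Ph k => x j.1))
    (hker : ∀ w, FreeGroup.lift x w = 1 → w ∈ Subgroup.normalClosure {nonorientableRelator k})
    (hx : Subgroup.closure (Set.range x) = ⊤)
    (hz : ∀ c : Fin k → Multiplicative (ZMod 2), ∃ f : G →* Multiplicative (ZMod 2),
      ∀ i, f (x i) = c i) (n : ℕ) :
    ∀ (φ ψ : FreeGroup (Fin n) →* G), Function.Surjective φ → Function.Surjective ψ →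
      ∃ α : FreeGroup (Fin n) ≃* FreeGroup (Fin n), ψ.comp α.toMonoidHom = φ := by
  induction n with
  | zero =>
    intro φ ψ _ _
    exact ⟨MulEquiv.refl _, by ext i; exact i.elim0⟩
  | succ m IH =>
    intro φ ψ hφ hψ
    have std : ∀ φ : FreeGroup (Fin (m + 1)) →* G, Function.Surjective φ → Red φ ∨
        (m + 1 ≤ k ∧ ∃ (e : FreeGroup (Fin k) ≃* FreeGroup (Fin (m + 1))) (g : G),
          ∀ i, φ (e (FreeGroup.of i)) = g * x i * g⁻¹) := by
      intro φ hφ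
      rcases MG.red_or_rose (x := x) hφ hrel hker hx with h | ⟨Y, h1, h2, h3, h4⟩
      · exact Or.inl h
      · right
        obtain ⟨e, g, h⟩ := MG.std_of_rose Y h1 h2 h3 h4
        refine ⟨?_, e, g, h⟩
        refine card_gen FreeGroup.of (fun c => ⟨FreeGroup.lift c, by simp⟩) (Fin k) (Nat.card_fin k)
          (fun i => e (FreeGroup.of i)) ?_
        have : Set.range (fun i => e (FreeGroup.of i)) =
            e.toMonoidHom '' Set.range FreeGroup.of := by
          rw [← Set.range_comp]; rfl
        rw [this, ← MonoidHom.map_closure, FreeGroup.closure_range_of, ← MonoidHom.range_eq_map,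
          MonoidHom.range_eq_top]
        exact e.surjective
    rcases std φ hφ with h1 | ⟨c1, e1, g1, h1⟩ <;> rcases std ψ hψ with h2 | ⟨c2, e2, g2, h2⟩
    · obtain ⟨θ, hθ⟩ := red_last φ h1
      obtain ⟨η, hη⟩ := red_last ψ h2
      obtain ⟨α, hα⟩ := IH _ _
        (restrict_surj (φ.comp θ.toMonoidHom) (hφ.comp θ.surjective) hθ)
        (restrict_surj (ψ.comp η.toMonoidHom) (hψ.comp η.surjective) hη)
      let β : FreeGroup (Fin (m + 1)) ≃* FreeGroup (Fin (m + 1)) :=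
        MonoidHom.toMulEquiv (extLast α.toMonoidHom) (extLast α.symm.toMonoidHom)
          (extLast_comp _ _ (by ext i; simp)) (extLast_comp _ _ (by ext i; simp))
      have hβ : ∀ w, ψ (η (β w)) = φ (θ w) := by
        intro w
        have : (ψ.comp η.toMonoidHom).comp (extLast α.toMonoidHom) = φ.comp θ.toMonoidHom := by
          ext i
          refine Fin.lastCases ?_ (fun i => ?_) i
          · rw [MonoidHom.comp_apply, extLast_last]
            exact hη.trans hθ.symm
          · have a1 := extLast_map α.toMonoidHom (FreeGroup.of i)
            rw [FreeGroup.map.of] at a1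
            rw [MonoidHom.comp_apply, a1]
            have a2 := DFunLike.congr_fun hα (FreeGroup.of i)
            simpa using a2
        exact DFunLike.congr_fun this w
      refine ⟨(θ.symm.trans β).trans η, ?_⟩
      refine MonoidHom.ext fun w => ?_
      have := hβ (θ.symm w)
      rw [MulEquiv.apply_symm_apply] at this
      exact this
    · have := red_card φ hφ h1 x hz; omega
    · have := red_card ψ hψ h2 x hz; omega
    · obtain ⟨q, hq⟩ := hψ (g1 * g2⁻¹)
      have key : ∀ w, ψ (q * e2 w * q⁻¹) = φ (e1 w) := by
        intro w
        have : (ψ.comp (MulAut.conj q).toMonoidHom).comp e2.toMonoidHom =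
            φ.comp e1.toMonoidHom := by
          ext i
          simp [h1, h2, hq, mul_assoc]
        have := DFunLike.congr_fun this w
        simpa using this
      refine ⟨(e1.symm.trans e2).trans (MulAut.conj q), ?_⟩
      refine MonoidHom.ext fun w => ?_
      have := key (e1.symm w)
      rw [MulEquiv.apply_symm_apply] at this
      exact this

theorem hz_surface (k : ℕ) (c : Fin k → Multiplicative (ZMod 2)) :
    ∃ f : NonorientableSurfaceGroup k →* Multiplicative (ZMod 2),
      ∀ i, f (standardRho k (FreeGroup.of i)) = c i := by
  have h : ∀ r ∈ ({nonorientableRelator k} : Set _), FreeGroup.lift c r = 1 := by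
    rintro _ rfl
    have h2 : ∀ a : Multiplicative (ZMod 2), a ^ 2 = 1 := by decide
    unfold nonorientableRelator
    rw [map_list_prod]
    apply List.prod_eq_one
    intro a ha
    simp only [List.map_map, List.mem_map] at ha
    obtain ⟨i, _, rfl⟩ := ha
    simp [h2]
  exact ⟨PresentedGroup.toGroup h, fun i => PresentedGroup.toGroup.of h⟩

theorem lift_standard (k : ℕ) (w : FreeGroup (Fin k)) :
    FreeGroup.lift (fun i => standardRho k (FreeGroup.of i)) w = standardRho k w := by
  have : FreeGroup.lift (fun i => standardRho k (FreeGroup.of i)) = standardRho k := by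
    ext i; simp
  rw [this]

end NSG

theorem aut_transitive_on_epis_nonorientable_surface_group (k n : ℕ) (hk : 1 ≤ k)
    (φ ψ : FreeGroup (Fin n) →* NonorientableSurfaceGroup k)
    (hφ : Function.Surjective φ) (hψ : Function.Surjective ψ) :
    ∃ α : FreeGroup (Fin n) ≃* FreeGroup (Fin n), ψ.comp α.toMonoidHom = φ := by
  have : NeZero k := ⟨by omega⟩
  have hsurj : Function.Surjective (standardRho k) := PresentedGroup.mk_surjective _
  refine NSG.transitive (fun i => standardRho k (FreeGroup.of i)) ?_ ?_ ?_ (NSG.hz_surface k) n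
    φ ψ hφ hψ
  · refine NSG.triv_of _ (0, false) ?_
    rw [NSG.hol_relator (fun i => standardRho k (FreeGroup.of i)), NSG.lift_standard]
    exact PresentedGroup.one_of_mem rfl
  · intro w hw
    rw [NSG.lift_standard] at hw
    exact PresentedGroup.mk_eq_one_iff.1 hw
  · have : Set.range (fun i => standardRho k (FreeGroup.of i)) =
        standardRho k '' Set.range FreeGroup.of := by
      rw [← Set.range_comp]; rfl
    rw [this, ← MonoidHom.map_closure, FreeGroup.closure_range_of, ← MonoidHom.range_eq_map,
      MonoidHom.range_eq_top]
    exact hsurj
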